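/- arXiv:1609.09740 — 8 statements merged into one kernel-verified Lean document; each statement's English description precedes it below -/
import Mathlib

section
/- Let v₁, v₂, v₃ be three points of ℤ³ each of whose third coordinate equals 1, and assume they are affinely independent. If the only points of ℤ³ lying in the convex hull (taken in ℝ³) of {v₁, v₂, v₃} are v₁, v₂ and v₃ themselves, then the determinant of the 3×3 integer matrix with rows v₁, v₂, v₃ equals 1 or −1; equivalently, v₁, v₂, v₃ form a ℤ-basis of the lattice ℤ³. -/
/-- The canonical embedding of the lattice `ℤ³` into `ℝ³`. -/
def latticeEmbed3 (p : Fin 3 → ℤ) : Fin 3 → ℝ := fun i => (p i : ℝ)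

theorem core_aux (a1 a2 b1 b2 D : ℤ) (hD : D = a1 * b2 - a2 * b1) (h1 : 1 < D) :
    ∃ x y S T : ℤ, D * x = S * a1 + T * b1 ∧ D * y = S * a2 + T * b2 ∧ 0 ≤ S ∧ S < D ∧
      0 ≤ T ∧ T < D ∧ S + T ≤ D ∧ ¬ (S = 0 ∧ T = 0) := by
  have hex : ∃ x y : ℤ, ¬ (D ∣ x * b2 - y * b1 ∧ D ∣ a1 * y - a2 * x) := by
    by_contra! h
    obtain ⟨⟨k1, e1⟩, ⟨k2, e2⟩⟩ := h 1 0
    obtain ⟨⟨k3, e3⟩, ⟨k4, e4⟩⟩ := h 0 1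
    have hb2 : b2 = D * k1 := by linarith
    have ha2 : a2 = - (D * k2) := by linarith
    have hb1 : b1 = - (D * k3) := by linarith
    have ha1 : a1 = D * k4 := by linarith
    have : D * 1 = D * (D * (k4 * k1 - k2 * k3)) := by
      rw [ha1, hb2, ha2, hb1] at hD
      linear_combination hD
    have h2 := mul_left_cancel₀ (by omega : D ≠ 0) this
    have h3 : D ∣ 1 := ⟨_, h2⟩
    have := Int.le_of_dvd one_pos h3
    omega
  obtain ⟨x0, y0, hn⟩ := hex
  have pos : 0 < D := by omega
  set S0 := x0 * b2 - y0 * b1 with hS0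
  set T0 := a1 * y0 - a2 * x0 with hT0
  have eS := Int.emod_add_mul_ediv S0 D
  have eT := Int.emod_add_mul_ediv T0 D
  have s0 := Int.emod_nonneg S0 pos.ne'
  have t0 := Int.emod_nonneg T0 pos.ne'
  have s1 := Int.emod_lt_of_pos S0 pos
  have t1 := Int.emod_lt_of_pos T0 pos
  have hne : ¬ (S0 % D = 0 ∧ T0 % D = 0) := fun h =>
    hn ⟨Int.dvd_of_emod_eq_zero h.1, Int.dvd_of_emod_eq_zero h.2⟩
  generalize S0 % D = r at *
  generalize T0 % D = t at *
  generalize S0 / D = q at *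
  generalize T0 / D = u at *
  have hx : D * (x0 - q * a1 - u * b1) = r * a1 + t * b1 := by
    linear_combination x0 * hD - a1 * eS - b1 * eT + a1 * hS0 + b1 * hT0
  have hy : D * (y0 - q * a2 - u * b2) = r * a2 + t * b2 := by
    linear_combination y0 * hD - a2 * eS - b2 * eT + a2 * hS0 + b2 * hT0
  by_cases hle : r + t ≤ D
  · exact ⟨_, _, r, t, hx, hy, s0, s1, t0, t1, hle, hne⟩
  · refine ⟨a1 + b1 - (x0 - q * a1 - u * b1), a2 + b2 - (y0 - q * a2 - u * b2), D - r, D - t,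
      by linear_combination -hx, by linear_combination -hy, ?_, ?_, ?_, ?_, ?_, ?_⟩ <;> omega

theorem hull_aux (v₁ v₂ v₃ : Fin 3 → ℤ)
    (h₁ : v₁ 2 = 1) (h₂ : v₂ 2 = 1) (h₃ : v₃ 2 = 1)
    (h : 1 < Matrix.det (Matrix.of ![v₁, v₂, v₃])) :
    ∃ p : Fin 3 → ℤ,
      latticeEmbed3 p ∈ convexHull ℝ {latticeEmbed3 v₁, latticeEmbed3 v₂, latticeEmbed3 v₃} ∧
      ¬ (p = v₁ ∨ p = v₂ ∨ p = v₃) := by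
  obtain ⟨D, hDd⟩ : ∃ D, D = Matrix.det (Matrix.of ![v₁, v₂, v₃]) := ⟨_, rfl⟩
  rw [← hDd] at h
  have hD : D = (v₂ 0 - v₁ 0) * (v₃ 1 - v₁ 1) - (v₂ 1 - v₁ 1) * (v₃ 0 - v₁ 0) := by
    rw [hDd, Matrix.det_fin_three]
    simp [h₁, h₂, h₃]
    ring
  obtain ⟨x, y, S, T, hx, hy, s0, s1, t0, t1, hle, hne⟩ := core_aux _ _ _ _ D hD h
  have hD0 : D ≠ 0 := by omega
  refine ⟨![v₁ 0 + x, v₁ 1 + y, 1], ?_, ?_⟩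
  · have hDR : (0 : ℝ) < D := by exact_mod_cast (by omega : 0 < D)
    have hxR : (D : ℝ) * x = S * (v₂ 0 - v₁ 0) + T * (v₃ 0 - v₁ 0) := by exact_mod_cast hx
    have hyR : (D : ℝ) * y = S * (v₂ 1 - v₁ 1) + T * (v₃ 1 - v₁ 1) := by exact_mod_cast hy
    have key : latticeEmbed3 ![v₁ 0 + x, v₁ 1 + y, 1] =
        (((D - S - T : ℤ) : ℝ) / D) • latticeEmbed3 v₁ + ((S : ℝ) / D) • latticeEmbed3 v₂
          + ((T : ℝ) / D) • latticeEmbed3 v₃ := by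
      ext i
      fin_cases i
      · simp [latticeEmbed3]
        field_simp
        linear_combination hxR
      · simp [latticeEmbed3]
        field_simp
        linear_combination hyR
      · simp [latticeEmbed3, h₁, h₂, h₃]
        field_simp
        ring
    rw [key]
    have hc := convex_convexHull ℝ ({latticeEmbed3 v₁, latticeEmbed3 v₂, latticeEmbed3 v₃} : Set (Fin 3 → ℝ))
    have hs := subset_convexHull ℝ ({latticeEmbed3 v₁, latticeEmbed3 v₂, latticeEmbed3 v₃} : Set (Fin 3 → ℝ))
    have := hc.sum_mem (t := Finset.univ)
      (w := ![((D - S - T : ℤ) : ℝ) / D, (S : ℝ) / D, (T : ℝ) / D])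
      (z := ![latticeEmbed3 v₁, latticeEmbed3 v₂, latticeEmbed3 v₃]) ?_ ?_ ?_
    · simpa [Fin.sum_univ_three] using this
    · have e1 : (0 : ℝ) ≤ ((D - S - T : ℤ) : ℝ) := by exact_mod_cast (by omega : 0 ≤ D - S - T)
      have e2 : (0 : ℝ) ≤ (S : ℝ) := by exact_mod_cast s0
      have e3 : (0 : ℝ) ≤ (T : ℝ) := by exact_mod_cast t0
      intro i _
      fin_cases i
      · exact div_nonneg e1 hDR.le
      · exact div_nonneg e2 hDR.le
      · exact div_nonneg e3 hDR.le
    · simp [Fin.sum_univ_three]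
      field_simp
      ring
    · intro i _
      apply hs
      fin_cases i <;> simp
  · have hS : D * S = D * (x * (v₃ 1 - v₁ 1) - y * (v₃ 0 - v₁ 0)) := by
      linear_combination S * hD - (v₃ 1 - v₁ 1) * hx + (v₃ 0 - v₁ 0) * hy
    have hT : D * T = D * (y * (v₂ 0 - v₁ 0) - x * (v₂ 1 - v₁ 1)) := by
      linear_combination T * hD + (v₂ 1 - v₁ 1) * hx - (v₂ 0 - v₁ 0) * hy
    replace hS := mul_left_cancel₀ hD0 hS
    replace hT := mul_left_cancel₀ hD0 hT
    rintro (e | e | e)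
    all_goals
      have e0 := congrFun e 0
      have e1 := congrFun e 1
      simp only [Matrix.cons_val_zero, Matrix.cons_val_one] at e0 e1
    · have hx0 : x = 0 := by omega
      have hy0 : y = 0 := by omega
      subst hx0 hy0
      exact hne ⟨by simpa using hS, by simpa using hT⟩
    · have hx0 : x = v₂ 0 - v₁ 0 := by omega
      have hy0 : y = v₂ 1 - v₁ 1 := by omega
      rw [hx0, hy0] at hS
      linarith
    · have hx0 : x = v₃ 0 - v₁ 0 := by omega
      have hy0 : y = v₃ 1 - v₁ 1 := by omega
      rw [hx0, hy0] at hT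
      linarith

theorem det_ne_aux (v₁ v₂ v₃ : Fin 3 → ℤ)
    (h₁ : v₁ 2 = 1) (h₂ : v₂ 2 = 1) (h₃ : v₃ 2 = 1)
    (hindep : AffineIndependent ℝ ![latticeEmbed3 v₁, latticeEmbed3 v₂, latticeEmbed3 v₃]) :
    Matrix.det (Matrix.of ![v₁, v₂, v₃]) ≠ 0 := by
  intro h0
  have hR : Matrix.det (Matrix.of ![latticeEmbed3 v₁, latticeEmbed3 v₂, latticeEmbed3 v₃]) = 0 := by
    have : ((Matrix.det (Matrix.of ![v₁, v₂, v₃]) : ℤ) : ℝ) = 0 := by exact_mod_cast h0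
    rw [← this, Matrix.det_fin_three, Matrix.det_fin_three]
    simp [latticeEmbed3]
  obtain ⟨w, hw, hw0⟩ := Matrix.exists_vecMul_eq_zero_iff.mpr hR
  apply hw
  have hc : ∀ j, w 0 * latticeEmbed3 v₁ j + w 1 * latticeEmbed3 v₂ j
      + w 2 * latticeEmbed3 v₃ j = 0 := by
    intro j
    have := congrFun hw0 j
    simpa [Matrix.vecMul, dotProduct, Fin.sum_univ_three] using this
  rw [affineIndependent_iff] at hindep
  have := hindep Finset.univ w ?_ ?_
  · ext i
    exact this i (Finset.mem_univ _)
  · have := hc 2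
    simpa [latticeEmbed3, h₁, h₂, h₃, Fin.sum_univ_three] using this
  · ext j
    simpa [Fin.sum_univ_three] using hc j

/-- An empty lattice triangle at height 1: if `v₁, v₂, v₃ ∈ ℤ³` have third coordinate `1`,
are affinely independent, and the only lattice points in their convex hull are the three
points themselves, then the matrix with rows `v₁, v₂, v₃` has determinant `±1`,
i.e. `v₁, v₂, v₃` form a `ℤ`-basis of `ℤ³`. -/
theorem stmt1 (v₁ v₂ v₃ : Fin 3 → ℤ)
    (h₁ : v₁ 2 = 1) (h₂ : v₂ 2 = 1) (h₃ : v₃ 2 = 1)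
    (hindep : AffineIndependent ℝ ![latticeEmbed3 v₁, latticeEmbed3 v₂, latticeEmbed3 v₃])
    (hempty : ∀ p : Fin 3 → ℤ,
      latticeEmbed3 p ∈ convexHull ℝ {latticeEmbed3 v₁, latticeEmbed3 v₂, latticeEmbed3 v₃} →
      p = v₁ ∨ p = v₂ ∨ p = v₃) :
    Matrix.det (Matrix.of ![v₁, v₂, v₃]) = 1 ∨ Matrix.det (Matrix.of ![v₁, v₂, v₃]) = -1 := by
  have hne := det_ne_aux v₁ v₂ v₃ h₁ h₂ h₃ hindep
  have hle : ¬ 1 < Matrix.det (Matrix.of ![v₁, v₂, v₃]) := by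
    intro h
    obtain ⟨p, hp, hn⟩ := hull_aux v₁ v₂ v₃ h₁ h₂ h₃ h
    exact hn (hempty p hp)
  have hge : ¬ 1 < - Matrix.det (Matrix.of ![v₁, v₂, v₃]) := by
    intro h
    have e : - Matrix.det (Matrix.of ![v₁, v₂, v₃]) = Matrix.det (Matrix.of ![v₁, v₃, v₂]) := by
      rw [Matrix.det_fin_three, Matrix.det_fin_three]
      simp
      ring
    rw [e] at h
    obtain ⟨p, hp, hn⟩ := hull_aux v₁ v₃ v₂ h₁ h₃ h₂ h
    rw [Set.pair_comm] at hp
    have := hempty p hp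
    tauto
  omega
end

section
/- Let Δ be a reflexive lattice polygon in ℝ² and let ∇ = {x ∈ ℝ² : ⟨x, y⟩ ≥ −1 for all y ∈ Δ} be its dual polygon. Then the number of points of ℤ² lying on the topological boundary of Δ plus the number of points of ℤ² lying on the topological boundary of ∇ equals 12. -/
/-- The canonical embedding of the lattice `ℤ²` into `ℝ²`. -/
def latticeEmbed (p : Fin 2 → ℤ) : Fin 2 → ℝ := fun i => (p i : ℝ)

/-- A lattice polygon: the convex hull in `ℝ²` of a finite set of lattice points,
with nonempty interior. -/
def IsLatticePolygon (Δ : Set (Fin 2 → ℝ)) : Prop :=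
  (∃ S : Finset (Fin 2 → ℤ), Δ = convexHull ℝ (latticeEmbed '' ↑S)) ∧ (interior Δ).Nonempty

/-- The dual polygon `∇ = {x | ⟨x, y⟩ ≥ -1 for all y ∈ Δ}`, with respect to the standard
inner product on `ℝ²`. -/
def dualPolygon (Δ : Set (Fin 2 → ℝ)) : Set (Fin 2 → ℝ) :=
  {x | ∀ y ∈ Δ, -1 ≤ x 0 * y 0 + x 1 * y 1}

/-- A lattice polygon `Δ` is reflexive if the origin lies in its interior and its dual
polygon is again a lattice polygon, i.e. it equals the convex hull of its lattice points. -/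
def IsReflexive (Δ : Set (Fin 2 → ℝ)) : Prop :=
  IsLatticePolygon Δ ∧ (0 : Fin 2 → ℝ) ∈ interior Δ ∧
    dualPolygon Δ = convexHull ℝ (dualPolygon Δ ∩ Set.range latticeEmbed)


structure Pol (A T : Set (ℤ × ℤ)) : Prop where
  finA : A.Finite
  finT : T.Finite
  memA : ∀ x y, (x, y) ∈ A ↔ ∀ X Y, (X, Y) ∈ T → -1 ≤ x * X + y * Y
  memT : ∀ X Y, (X, Y) ∈ T ↔ ∀ x y, (x, y) ∈ A → -1 ≤ x * X + y * Y

namespace Pol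

variable {A T : Set (ℤ × ℤ)}

theorem symm (h : Pol A T) : Pol T A where
  finA := h.finT
  finT := h.finA
  memA X Y := by simp only [h.memT X Y, mul_comm]
  memT X Y := by simp only [h.memA X Y, mul_comm]

theorem pair (h : Pol A T) {x y X Y : ℤ} (h1 : (x, y) ∈ A) (h2 : (X, Y) ∈ T) :
    -1 ≤ x * X + y * Y := (h.memA x y).1 h1 X Y h2

theorem exT (h : Pol A T) (x y : ℤ) (hne : (x, y) ≠ 0) :
    ∃ X Y, (X, Y) ∈ T ∧ x * X + y * Y < 0 := by
  by_contra! hc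
  refine (Set.infinite_of_injective_forall_mem (f := fun k : ℕ => ((k * x, k * y) : ℤ × ℤ))
    ?_ ?_) h.finA
  · intro k l hkl
    simp only [Prod.mk.injEq] at hkl
    by_contra hne'
    have : (k : ℤ) - l ≠ 0 := by omega
    apply hne
    have h1 : ((k : ℤ) - l) * x = 0 := by linarith [hkl.1]
    have h2 : ((k : ℤ) - l) * y = 0 := by linarith [hkl.2]
    simp only [mul_eq_zero, this, false_or] at h1 h2
    simp [h1, h2]
  · intro k
    rw [h.memA]
    intro X Y hT
    have := hc X Y hT
    have h2 : (0 : ℤ) ≤ k := by positivity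
    nlinarith [mul_nonneg h2 this]

theorem exA (h : Pol A T) (X Y : ℤ) (hne : (X, Y) ≠ 0) :
    ∃ x y, (x, y) ∈ A ∧ x * X + y * Y < 0 := by
  obtain ⟨x, y, h1, h2⟩ := h.symm.exT X Y hne
  exact ⟨x, y, h1, by linarith⟩

theorem trans (h : Pol A T) (a b c d e : ℤ) (hd : a * d - b * c = e) (he : e * e = 1) :
    ∃ A' T' : Set (ℤ × ℤ), Pol A' T' ∧ A'.ncard = A.ncard ∧ T'.ncard = T.ncard ∧
      (∀ x y, (x, y) ∈ A' ↔ (a * x + b * y, c * x + d * y) ∈ A) ∧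
      (∀ x y, (x, y) ∈ T' ↔ (e * (d * x - c * y), e * (-b * x + a * y)) ∈ T) := by
  let f : ℤ × ℤ ≃ ℤ × ℤ :=
    { toFun := fun p => (a * p.1 + b * p.2, c * p.1 + d * p.2)
      invFun := fun p => (e * (d * p.1 - b * p.2), e * (-c * p.1 + a * p.2))
      left_inv := by
        rintro ⟨x, y⟩
        ext
        · linear_combination e * x * hd + x * he
        · linear_combination e * y * hd + y * he
      right_inv := by
        rintro ⟨x, y⟩
        ext
        · linear_combination e * x * hd + x * he
        · linear_combination e * y * hd + y * he }
  let g : ℤ × ℤ ≃ ℤ × ℤ :=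
    { toFun := fun p => (e * (d * p.1 - c * p.2), e * (-b * p.1 + a * p.2))
      invFun := fun p => (a * p.1 + c * p.2, b * p.1 + d * p.2)
      left_inv := by
        rintro ⟨x, y⟩
        ext
        · linear_combination e * x * hd + x * he
        · linear_combination e * y * hd + y * he
      right_inv := by
        rintro ⟨x, y⟩
        ext
        · linear_combination e * x * hd + x * he
        · linear_combination e * y * hd + y * he }
  have key : ∀ x y X Y : ℤ, (f (x, y)).1 * (g (X, Y)).1 + (f (x, y)).2 * (g (X, Y)).2
      = x * X + y * Y := by
    intro x y X Y
    change (a * x + b * y) * (e * (d * X - c * Y)) + (c * x + d * y) * (e * (-b * X + a * Y)) = _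
    linear_combination e * (x * X + y * Y) * hd + (x * X + y * Y) * he
  refine ⟨f ⁻¹' A, g ⁻¹' T, ⟨?_, ?_, ?_, ?_⟩, ?_, ?_, fun x y => Iff.rfl, fun x y => Iff.rfl⟩
  · exact h.finA.preimage f.injective.injOn
  · exact h.finT.preimage g.injective.injOn
  · intro x y
    constructor
    · intro hx X Y hX
      rw [← key]
      exact h.pair hx hX
    · intro hx
      refine (h.memA _ _).2 fun X Y hX => ?_
      have := hx (g.symm (X, Y)).1 (g.symm (X, Y)).2 (by simpa using hX)
      rw [← key] at this
      simp only [Prod.mk.eta, Equiv.apply_symm_apply] at this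
      exact this
  · intro x y
    constructor
    · intro hx X Y hX
      rw [← key]
      exact h.pair hX hx
    · intro hx
      refine (h.memT _ _).2 fun X Y hX => ?_
      have := hx (f.symm (X, Y)).1 (f.symm (X, Y)).2 (by simpa using hX)
      rw [← key] at this
      simp only [Prod.mk.eta, Equiv.apply_symm_apply] at this
      exact this
  · rw [← Equiv.image_symm_eq_preimage]; exact Set.ncard_image_of_injective _ f.symm.injective
  · rw [← Equiv.image_symm_eq_preimage]; exact Set.ncard_image_of_injective _ g.symm.injective

theorem half (h : Pol A T) (h1 : ((1 : ℤ), (0 : ℤ)) ∈ A) (h2 : ((-1 : ℤ), (0 : ℤ)) ∈ A) (α γ : ℤ)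
    (hα : (-1, α) ∈ T) (hα' : ∀ y, (-1, y) ∈ T → α ≤ y)
    (hγ : (1, γ) ∈ T) (hγ' : ∀ y, (1, y) ∈ T → γ ≤ y) :
    (({v ∈ A | 0 < v.2}.ncard : ℕ) : ℤ) + ({w ∈ T | w.1 = 0 ∧ w.2 < 0}.ncard : ℕ) = 4 + α + γ := by
  have hX : ∀ X Y, (X, Y) ∈ T → X = -1 ∨ X = 0 ∨ X = 1 := by
    intro X Y hT
    have := h.pair h1 hT
    have := h.pair h2 hT
    omega
  obtain ⟨x₀, y₀, hA₀, hy₀⟩ := h.exA 0 (-1) (by simp)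
  have h0 : ∀ Y, (0, Y) ∈ T → -1 ≤ Y := by
    intro Y hT
    have := h.pair hA₀ hT
    by_contra! hc
    nlinarith
  have hy : ∀ x y, (x, y) ∈ A → -2 ≤ y * (α + γ) := by
    intro x y hA
    have := h.pair hA hα
    have := h.pair hA hγ
    linarith
  have hs : -2 ≤ α + γ := by
    have := hy _ _ hA₀
    by_contra! hc
    nlinarith
  by_cases hm : ((0 : ℤ), (-1 : ℤ)) ∈ T
  · have e1 : {v ∈ A | 0 < v.2} = ↑((Finset.Icc (-1 - γ) (1 + α)) ×ˢ ({1} : Finset ℤ)) := by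
      ext ⟨x, y⟩
      simp only [Set.mem_ofPred_eq, Finset.coe_product, Set.mem_prod, Finset.mem_coe,
        Finset.mem_Icc, Finset.mem_singleton]
      constructor
      · rintro ⟨hA, hp⟩
        have a1 := h.pair hA hm
        have a2 := h.pair hA hα
        have a3 := h.pair hA hγ
        obtain rfl : y = 1 := by omega
        omega
      · rintro ⟨⟨b1, b2⟩, rfl⟩
        refine ⟨(h.memA _ _).2 ?_, by norm_num⟩
        intro X Y hT
        rcases hX X Y hT with rfl | rfl | rfl
        · have := hα' _ hT; omega
        · have := h0 _ hT; omega
        · have := hγ' _ hT; omega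
    have e2 : {w ∈ T | w.1 = 0 ∧ w.2 < 0} = {(0, -1)} := by
      ext ⟨x, y⟩
      simp only [Set.mem_ofPred_eq, Set.mem_singleton_iff, Prod.mk.injEq]
      constructor
      · rintro ⟨hA, rfl, hp⟩
        have := h0 _ hA
        omega
      · rintro ⟨rfl, rfl⟩
        exact ⟨hm, rfl, by norm_num⟩
    rw [e1, e2, Set.ncard_coe_finset, Set.ncard_singleton, Finset.card_product, Int.card_Icc]
    simp
    omega
  · have h0' : ∀ Y, (0, Y) ∈ T → 0 ≤ Y := by
      intro Y hT
      have := h0 _ hT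
      by_contra! hc
      obtain rfl : Y = -1 := by omega
      exact hm hT
    have hs1 : -1 ≤ α + γ := by
      rw [h.memT] at hm
      push Not at hm
      obtain ⟨x, y, hA, hlt⟩ := hm
      have := hy _ _ hA
      by_contra! hc
      nlinarith
    have hs2 : α + γ < 0 := by
      by_contra! hc
      obtain ⟨X, Y, hT, hlt⟩ := h.exT α 1 (by simp)
      rcases hX X Y hT with rfl | rfl | rfl
      · have := hα' _ hT; omega
      · have := h0' _ hT; omega
      · have := hγ' _ hT; omega
    obtain rfl : γ = -1 - α := by omega
    have e1 : {v ∈ A | 0 < v.2} = ↑({(α, 1), (1 + α, 1), (1 + 2 * α, 2)} : Finset (ℤ × ℤ)) := by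
      ext ⟨x, y⟩
      simp only [Set.mem_ofPred_eq, Finset.mem_coe, Finset.mem_insert,
        Finset.mem_singleton, Prod.mk.injEq]
      constructor
      · rintro ⟨hA, hp⟩
        have a1 := hy _ _ hA
        have a2 := h.pair hA hα
        have a3 := h.pair hA hγ
        have : y = 1 ∨ y = 2 := by
          have : y ≤ 2 := by linarith
          omega
        rcases this with rfl | rfl <;> omega
      · intro hh
        have hp : 0 < y := by omega
        refine ⟨(h.memA _ _).2 ?_, hp⟩
        intro X Y hT
        rcases hX X Y hT with rfl | rfl | rfl
        · have := hα' _ hT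
          rcases hh with ⟨rfl, rfl⟩ | ⟨rfl, rfl⟩ | ⟨rfl, rfl⟩ <;> omega
        · have := h0' _ hT
          nlinarith
        · have := hγ' _ hT
          rcases hh with ⟨rfl, rfl⟩ | ⟨rfl, rfl⟩ | ⟨rfl, rfl⟩ <;> omega
    have e2 : {w ∈ T | w.1 = 0 ∧ w.2 < 0} = ∅ := by
      ext ⟨x, y⟩
      simp only [Set.mem_ofPred_eq, Set.mem_empty_iff_false, iff_false]
      rintro ⟨hA, rfl, hp⟩
      have := h0' _ hA
      omega
    rw [e1, e2, Set.ncard_coe_finset, Set.ncard_empty, Finset.card_insert_of_notMem,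
      Finset.card_insert_of_notMem, Finset.card_singleton]
    · push_cast; ring
    · simp
    · simp

theorem exMax {s : Set ℤ} (hs : s.Finite) (hn : s.Nonempty) : ∃ m ∈ s, ∀ y ∈ s, y ≤ m := by
  obtain ⟨m, hm, h⟩ := hs.exists_maximalFor id s hn
  refine ⟨m, hm, fun y hy => ?_⟩
  by_contra! hc
  exact absurd (h hy hc.le) (by simpa using hc)

theorem exMin {s : Set ℤ} (hs : s.Finite) (hn : s.Nonempty) : ∃ m ∈ s, ∀ y ∈ s, m ≤ y := by
  obtain ⟨m, hm, h⟩ := hs.exists_minimalFor id s hn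
  refine ⟨m, hm, fun y hy => ?_⟩
  by_contra! hc
  exact absurd (h hy hc.le) (by simpa using hc)

theorem finSlice (h : T.Finite) (X : ℤ) : {y : ℤ | (X, y) ∈ T}.Finite :=
  h.preimage (f := fun y => (X, y)) (fun a _ b _ hab => by simpa using hab)

theorem finSlice' (h : T.Finite) (Y : ℤ) : {x : ℤ | (x, Y) ∈ T}.Finite :=
  h.preimage (f := fun x => (x, Y)) (fun a _ b _ hab => by simpa using hab)

theorem ncard_split3 {S : Set (ℤ × ℤ)} (hS : S.Finite) (f : ℤ × ℤ → ℤ) :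
    S.ncard = {v ∈ S | 0 < f v}.ncard + {v ∈ S | f v = 0}.ncard + {v ∈ S | f v < 0}.ncard := by
  have hf : ∀ p : ℤ × ℤ → Prop, {v ∈ S | p v}.Finite := fun p => hS.subset (Set.sep_subset _ _)
  rw [← Set.ncard_union_eq _ (hf _) (hf _), ← Set.ncard_union_eq _ ((hf _).union (hf _)) (hf _)]
  · congr 1
    ext v
    simp only [Set.mem_union, Set.mem_ofPred_eq]
    have := lt_trichotomy (f v) 0
    tauto
  · rw [Set.disjoint_left]
    rintro v (⟨_, h⟩ | ⟨_, h⟩) ⟨_, h'⟩ <;> omega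
  · rw [Set.disjoint_left]
    rintro v ⟨_, h⟩ ⟨_, h'⟩
    omega

theorem col (h : Pol A T) (X α β : ℤ) 
    (hα : (X, α) ∈ T) (hα' : ∀ y, (X, y) ∈ T → α ≤ y)
    (hβ : (X, β) ∈ T) (hβ' : ∀ y, (X, y) ∈ T → y ≤ β) :
    (({v ∈ T | v.1 = X}.ncard : ℕ) : ℤ) = β - α + 1 := by
  have e1 : {v ∈ T | v.1 = X} = ↑(({X} : Finset ℤ) ×ˢ (Finset.Icc α β)) := by
    ext ⟨x, y⟩
    simp only [Set.mem_ofPred_eq, Finset.coe_product, Set.mem_prod, Finset.mem_coe,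
        Finset.mem_Icc, Finset.mem_singleton]
    constructor
    · rintro ⟨hT, rfl⟩
      exact ⟨rfl, hα' _ hT, hβ' _ hT⟩
    · rintro ⟨rfl, b1, b2⟩
      refine ⟨(h.memT _ _).2 fun a b hA => ?_, rfl⟩
      have := h.pair hA hα
      have := h.pair hA hβ
      rcases le_total 0 b with hb | hb
      · nlinarith
      · nlinarith
  have := hα' _ hβ
  rw [e1, Set.ncard_coe_finset, Finset.card_product, Int.card_Icc]
  simp
  omega

theorem zero_mem (h : Pol A T) : ((0 : ℤ), (0 : ℤ)) ∈ A := by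
  rw [h.memA]; intros; omega

theorem count1 (h : Pol A T) (h1 : ((1 : ℤ), (0 : ℤ)) ∈ A) (h2 : ((-1 : ℤ), (0 : ℤ)) ∈ A) :
    A.ncard + T.ncard = 14 := by
  have hX : ∀ X Y, (X, Y) ∈ T → X = -1 ∨ X = 0 ∨ X = 1 := by
    intro X Y hT
    have := h.pair h1 hT
    have := h.pair h2 hT
    omega
  have n1 : {y : ℤ | (1, y) ∈ T}.Nonempty := by
    obtain ⟨X, Y, hT, hlt⟩ := h.exT (-1) 0 (by simp)
    rcases hX X Y hT with rfl | rfl | rfl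
    · omega
    · omega
    · exact ⟨Y, hT⟩
  have n2 : {y : ℤ | (-1, y) ∈ T}.Nonempty := by
    obtain ⟨X, Y, hT, hlt⟩ := h.exT 1 0 (by simp)
    rcases hX X Y hT with rfl | rfl | rfl
    · exact ⟨Y, hT⟩
    · omega
    · omega
  obtain ⟨α, hα, hα'⟩ := exMin (finSlice h.finT (-1)) n2
  obtain ⟨β, hβ, hβ'⟩ := exMax (finSlice h.finT (-1)) n2
  obtain ⟨γ, hγ, hγ'⟩ := exMin (finSlice h.finT 1) n1
  obtain ⟨δ, hδ, hδ'⟩ := exMax (finSlice h.finT 1) n1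
  have c1 := h.col (-1) α β hα hα' hβ hβ'
  have c2 := h.col 1 γ δ hγ hγ' hδ hδ'
  have u1 := h.half h1 h2 α γ hα hα' hγ hγ'
  -- the reflected pair
  have u2 : (({v ∈ A | v.2 < 0}.ncard : ℕ) : ℤ) + ({w ∈ T | w.1 = 0 ∧ 0 < w.2}.ncard : ℕ)
      = 4 - β - δ := by
    obtain ⟨A', T', h', -, -, hA, hT⟩ := h.trans 1 0 0 (-1) (-1) (by norm_num) (by norm_num)
    have hA : ∀ x y, (x, y) ∈ A' ↔ (x, -y) ∈ A := by intro x y; rw [hA]; ring_nf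
    have hT : ∀ x y, (x, y) ∈ T' ↔ (x, -y) ∈ T := by intro x y; rw [hT]; ring_nf
    have := h'.half ((hA _ _).2 (by simpa using h1)) ((hA _ _).2 (by simpa using h2)) (-β) (-δ)
      ((hT _ _).2 (by simpa using hβ))
      (fun y hy => by have := hβ' _ ((hT _ _).1 hy); omega)
      ((hT _ _).2 (by simpa using hδ))
      (fun y hy => by have := hδ' _ ((hT _ _).1 hy); omega)
    have inj : Function.Injective (fun p : ℤ × ℤ => (p.1, -p.2)) := by
      rintro ⟨a, b⟩ ⟨c, d⟩ hh
      simpa using hh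
    have e1 : {v ∈ A | v.2 < 0} = (fun p : ℤ × ℤ => (p.1, -p.2)) '' {v ∈ A' | 0 < v.2} := by
      ext ⟨x, y⟩
      simp only [Set.mem_ofPred_eq, Set.mem_image, Prod.exists, Prod.mk.injEq, hA]
      constructor
      · rintro ⟨a, b⟩
        exact ⟨x, -y, ⟨by simpa using a, by omega⟩, rfl, by ring⟩
      · rintro ⟨a, b, ⟨c, d⟩, rfl, rfl⟩
        exact ⟨c, by omega⟩
    have e2 : {w ∈ T | w.1 = 0 ∧ 0 < w.2} =
        (fun p : ℤ × ℤ => (p.1, -p.2)) '' {v ∈ T' | v.1 = 0 ∧ v.2 < 0} := by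
      ext ⟨x, y⟩
      simp only [Set.mem_ofPred_eq, Set.mem_image, Prod.exists, Prod.mk.injEq, hT]
      constructor
      · rintro ⟨a, b, c⟩
        exact ⟨x, -y, ⟨by simpa using a, b, by omega⟩, rfl, by ring⟩
      · rintro ⟨a, b, ⟨c, d, e⟩, rfl, rfl⟩
        exact ⟨c, d, by omega⟩
    rw [e1, e2, Set.ncard_image_of_injective _ inj, Set.ncard_image_of_injective _ inj]
    omega
  have s1 := ncard_split3 h.finA Prod.snd
  have s2 := ncard_split3 h.finT Prod.fst
  have s3 := ncard_split3 (S := {v ∈ T | v.1 = 0}) (h.finT.subset (Set.sep_subset _ _)) Prod.snd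
  have m1 : {v ∈ A | v.2 = 0} = ↑({(-1, 0), (0, 0), (1, 0)} : Finset (ℤ × ℤ)) := by
    ext ⟨x, y⟩
    simp only [Set.mem_ofPred_eq, Finset.mem_coe, Finset.mem_insert,
        Finset.mem_singleton, Prod.mk.injEq]
    constructor
    · rintro ⟨hA, rfl⟩
      have := h.pair hA hα
      have := h.pair hA hγ
      omega
    · rintro (⟨rfl, rfl⟩ | ⟨rfl, rfl⟩ | ⟨rfl, rfl⟩)
      · exact ⟨h2, rfl⟩
      · exact ⟨h.zero_mem, rfl⟩
      · exact ⟨h1, rfl⟩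
  have m2 : {v ∈ T | 0 < v.1} = {v ∈ T | v.1 = 1} := by
    ext ⟨x, y⟩
    simp only [Set.mem_ofPred_eq, and_congr_right_iff]
    intro hT
    have := hX _ _ hT
    omega
  have m3 : {v ∈ T | v.1 < 0} = {v ∈ T | v.1 = -1} := by
    ext ⟨x, y⟩
    simp only [Set.mem_ofPred_eq, and_congr_right_iff]
    intro hT
    have := hX _ _ hT
    omega
  have m4 : {v ∈ {v ∈ T | v.1 = 0} | v.2 = 0} = {(0, 0)} := by
    ext ⟨x, y⟩
    simp only [Set.mem_ofPred_eq, Set.mem_singleton_iff, Prod.mk.injEq]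
    constructor
    · rintro ⟨⟨_, a⟩, b⟩; exact ⟨a, b⟩
    · rintro ⟨rfl, rfl⟩; exact ⟨⟨h.symm.zero_mem, rfl⟩, rfl⟩
  have m5 : {v ∈ {v ∈ T | v.1 = 0} | 0 < v.2} = {w ∈ T | w.1 = 0 ∧ 0 < w.2} := by
    ext; simp [and_assoc]
  have m6 : {v ∈ {v ∈ T | v.1 = 0} | v.2 < 0} = {w ∈ T | w.1 = 0 ∧ w.2 < 0} := by
    ext; simp [and_assoc]
  have m1' : {v ∈ A | v.2 = 0}.ncard = 3 := by
    rw [m1, Set.ncard_coe_finset]; rfl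
  rw [m1'] at s1
  rw [m2, m3] at s2
  rw [m4, m5, m6, Set.ncard_singleton] at s3
  omega

theorem count2 (h : Pol A T) (x y : ℤ) (h0 : (x, y) ≠ 0) (h1 : (x, y) ∈ A) (h2 : (-x, -y) ∈ A) :
    A.ncard + T.ncard = 14 := by
  obtain ⟨X, Y, hT, hlt⟩ := h.exT x y h0
  have := h.pair h1 hT
  obtain ⟨A', T', h', cA, cT, hA, -⟩ := h.trans x Y y (-X) 1 (by linarith) (by norm_num)
  rw [← cA, ← cT]
  apply h'.count1
  · rw [hA]; simpa using h1
  · rw [hA]; simpa using h2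

theorem floorUp (h : Pol A T) (hz : ((-1 : ℤ), (0 : ℤ)) ∈ A) {a b : ℤ} (hA : (a, b) ∈ A)
    (hb : 0 < b) : (a / b, 1) ∈ A := by
  rw [h.memA]
  intro X Y hT
  have e1 := h.pair hz hT
  have e2 := h.pair hA hT
  have e3 := Int.emod_add_mul_ediv a b
  have e4 := Int.emod_nonneg a hb.ne'
  have e5 := Int.emod_lt_of_pos a hb
  generalize a / b = m at *
  generalize a % b = r at *
  subst e3
  by_contra! hc
  have e6 : X ≤ 1 := by omega
  nlinarith [mul_nonneg e4 (sub_nonneg.2 e6), mul_pos hb (sub_pos.2 hc)]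

theorem floorDn (h : Pol A T) (hz : ((-1 : ℤ), (0 : ℤ)) ∈ A) {a b : ℤ} (hA : (a, b) ∈ A)
    (hb : b < 0) : (a / (-b), -1) ∈ A := by
  obtain ⟨A', T', h', -, -, hA', -⟩ := h.trans 1 0 0 (-1) (-1) (by norm_num) (by norm_num)
  have hA' : ∀ x y, (x, y) ∈ A' ↔ (x, -y) ∈ A := by intro x y; rw [hA']; ring_nf
  have := h'.floorUp ((hA' _ _).2 (by simpa using hz)) (a := a) (b := -b)
    ((hA' _ _).2 (by simpa using hA)) (by omega)
  exact (hA' _ _).1 this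

theorem count3 (h : Pol A T) (hz : ((-1 : ℤ), (0 : ℤ)) ∈ A) (hu : ((0 : ℤ), (1 : ℤ)) ∈ A)
    (hu' : ∀ x : ℤ, (x, 1) ∈ A → x ≤ 0) (q : ℤ) (hv : (q, -1) ∈ A)
    (hv' : ∀ x : ℤ, (x, -1) ∈ A → x ≤ q) : A.ncard + T.ncard = 14 := by
  by_contra hne
  have na : ∀ x y, (x, y) ≠ 0 → (x, y) ∈ A → (-x, -y) ∈ A → False :=
    fun x y h0 h1 h2 => hne (h.count2 x y h0 h1 h2)
  have na' : ∀ x y, (x, y) ≠ 0 → (x, y) ∈ T → (-x, -y) ∈ T → False :=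
    fun x y h0 h1 h2 => hne (by rw [add_comm]; exact h.symm.count2 x y h0 h1 h2)
  have n1 : ((1 : ℤ), (0 : ℤ)) ∉ A := fun h1 => na 1 0 (by simp) h1 (by simpa using hz)
  have n2 : ((0 : ℤ), (-1 : ℤ)) ∉ A := fun h1 => na 0 1 (by simp) hu (by simpa using h1)
  -- positive multiples of `(1,0)` are excluded
  have n3 : ∀ a : ℤ, 0 < a → (a, 0) ∉ A := by
    intro a ha hA
    apply n1
    rw [h.memA]
    intro X Y hT
    have := h.pair hA hT
    by_contra! hc
    nlinarith
  have up : ∀ a b : ℤ, (a, b) ∈ A → 0 < b → a < b := by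
    intro a b hA hb
    have := hu' _ (h.floorUp hz hA hb)
    by_contra! hc
    have : 1 ≤ a / b := by rw [Int.le_ediv_iff_mul_le hb]; omega
    omega
  have dn : ∀ a b : ℤ, (a, b) ∈ A → b < 0 → a < (q + 1) * (-b) := by
    intro a b hA hb
    have := hv' _ (h.floorDn hz hA hb)
    by_contra! hc
    have : q + 1 ≤ a / (-b) := by rw [Int.le_ediv_iff_mul_le (by omega)]; omega
    omega
  have q1 : -2 ≤ q := by
    obtain ⟨X, Y, hT, hlt⟩ := h.exT (-1) 0 (by simp)
    have := h.pair hz hT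
    obtain rfl : X = 1 := by omega
    have := h.pair hu hT
    have := h.pair hv hT
    omega
  have q2 : q < 2 := by
    by_contra! hc
    apply n1
    rw [h.memA]
    intro X Y hT
    have := h.pair hz hT
    have := h.pair hu hT
    have := h.pair hv hT
    by_contra! hc
    nlinarith
  have q3 : q ≠ 0 := by
    rintro rfl
    exact n2 hv
  have q4 : q ≠ -2 := by
    rintro rfl
    obtain ⟨a, b, hA, hlt⟩ := h.exA (-1) 1 (by simp)
    rcases lt_trichotomy b 0 with hb | rfl | hb
    · have := dn _ _ hA hb
      omega
    · exact n3 a (by omega) hA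
    · have := up _ _ hA hb
      omega
  have q5 : q ≠ -1 := by
    rintro rfl
    have m1 : ((1 : ℤ), (2 : ℤ)) ∈ A := by
      obtain ⟨a, b, hA, hlt⟩ := h.exA (-1) 0 (by simp)
      rcases lt_trichotomy b 0 with hb | rfl | hb
      · have := dn _ _ hA hb
        omega
      · exact absurd hA (n3 a (by omega))
      · have h1 := up _ _ hA hb
        have h2 : b = a + 1 := by
          obtain ⟨X, Y, hT, hlt⟩ := h.exT 0 1 (by simp)
          have := h.pair hu hT
          obtain rfl : Y = -1 := by omega
          have := h.pair hz hT
          have := h.pair hA hT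
          nlinarith
        subst h2
        rw [h.memA]
        intro X Y hT
        have := h.pair hz hT
        have := h.pair hu hT
        have := h.pair hA hT
        by_contra! hc
        nlinarith
    have m2 : ((-1 : ℤ), (-2 : ℤ)) ∈ A := by
      obtain ⟨a, b, hA, hlt⟩ := h.exA (-1) 1 (by simp)
      rcases lt_trichotomy b 0 with hb | rfl | hb
      · have h1 := dn _ _ hA hb
        have h2 : a = -1 := by
          obtain ⟨X, Y, hT, hlt⟩ := h.exT (-1) (-1) (by simp)
          have := h.pair hv hT
          obtain rfl : Y = 1 - X := by omega
          have := h.pair hz hT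
          have := h.pair hA hT
          nlinarith
        subst h2
        rw [h.memA]
        intro X Y hT
        have := h.pair hz hT
        have := h.pair hA hT
        by_contra! hc
        nlinarith
      · exact absurd hA (n3 a (by omega))
      · have h1 := up _ _ hA hb
        omega
    exact na 1 2 (by simp) m1 (by simpa using m2)
  obtain rfl : q = 1 := by omega
  have k1 : ∀ a b : ℤ, (a, b) ∈ A → b < 2 := by
    intro a b hA
    by_contra! hc
    rcases lt_trichotomy a 0 with ha | rfl | ha
    · refine na (-1) 1 (by simp) ?_ (by simpa using hv)
      rw [h.memA]
      intro X Y hT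
      have := h.pair hz hT
      have := h.pair hu hT
      have := h.pair hA hT
      by_contra! hc
      obtain rfl : X = 1 := by omega
      obtain rfl : Y = -1 := by omega
      omega
    · obtain ⟨X, Y, hT, hlt⟩ := h.exT 0 1 (by simp)
      have := h.pair hA hT
      nlinarith
    · apply n1
      rw [h.memA]
      intro X Y hT
      have := h.pair hv hT
      have := h.pair hu hT
      have := h.pair hA hT
      by_contra! hc
      obtain rfl : Y = -1 := by omega
      obtain rfl : X = -2 := by omega
      omega
  have k2 : ∀ a b : ℤ, (a, b) ∈ A → -2 < b := by
    intro a b hA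
    by_contra! hc
    rcases lt_trichotomy (a + b) 0 with ha | ha | ha
    · apply n2
      rw [h.memA]
      intro X Y hT
      have := h.pair hv hT
      have := h.pair hz hT
      have := h.pair hA hT
      by_contra! hc
      obtain rfl : X = 1 := by omega
      obtain rfl : Y = 2 := by omega
      omega
    · obtain rfl : a = -b := by omega
      obtain ⟨X, Y, hT, hlt⟩ := h.exT 1 (-1) (by simp)
      have := h.pair hA hT
      nlinarith
    · apply n1
      rw [h.memA]
      intro X Y hT
      have := h.pair hv hT
      have := h.pair hu hT
      have := h.pair hA hT
      by_contra! hc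
      obtain rfl : Y = -1 := by omega
      obtain rfl : X = -2 := by omega
      omega
  apply na' 0 1 (by simp)
  · rw [h.memT]
    intro x y hA
    have := k2 _ _ hA
    omega
  · rw [h.memT]
    intro x y hA
    have := k1 _ _ hA
    omega

theorem count4 (h : Pol A T) (hz : ((-1 : ℤ), (0 : ℤ)) ∈ A) : A.ncard + T.ncard = 14 := by
  have n1 : {x : ℤ | (x, 1) ∈ A}.Nonempty := by
    obtain ⟨a, b, hA, hlt⟩ := h.exA 0 (-1) (by simp)
    exact ⟨_, h.floorUp hz hA (by omega)⟩
  have n2 : {x : ℤ | (x, -1) ∈ A}.Nonempty := by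
    obtain ⟨a, b, hA, hlt⟩ := h.exA 0 1 (by simp)
    exact ⟨_, h.floorDn hz hA (by omega)⟩
  obtain ⟨p, hp, hp'⟩ := exMax (finSlice' h.finA 1) n1
  obtain ⟨q, hq, hq'⟩ := exMax (finSlice' h.finA (-1)) n2
  simp only [Set.mem_ofPred_eq] at hp hp' hq hq'
  obtain ⟨A', T', h', cA, cT, hA, -⟩ := h.trans 1 p 0 1 1 (by norm_num) (by norm_num)
  have hA : ∀ x y, (x, y) ∈ A' ↔ (x + p * y, y) ∈ A := by intro x y; rw [hA]; ring_nf
  rw [← cA, ← cT]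
  refine h'.count3 ?_ ?_ ?_ (p + q) ?_ ?_
  · rw [hA]; simpa using hz
  · rw [hA]; simpa using hp
  · intro x hx
    rw [hA] at hx
    have := hp' _ hx
    omega
  · rw [hA]; simpa using hq
  · intro x hx
    rw [hA] at hx
    have := hq' _ hx
    omega

theorem count (h : Pol A T) : A.ncard + T.ncard = 14 := by
  obtain ⟨x, y, hA, hlt⟩ := h.exA 1 0 (by simp)
  obtain ⟨X, Y, hT, hlt'⟩ := h.exT x y (by rintro hh; simp at hh; omega)
  have := h.pair hA hT
  obtain ⟨A', T', h', cA, cT, hA', -⟩ := h.trans (-x) (-Y) (-y) X 1 (by linarith) (by norm_num)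
  rw [← cA, ← cT]
  apply h'.count4
  rw [hA']; simpa using hA

end Pol

theorem interior_strict {K : Set (Fin 2 → ℝ)} {v : Fin 2 → ℝ} (hv : v ∈ interior K) (X Y : ℝ)
    (hK : ∀ z ∈ K, -1 ≤ X * z 0 + Y * z 1) : -1 < X * v 0 + Y * v 1 := by
  have hc : Continuous (fun t : ℝ => t • v) := by fun_prop
  have hn : ∀ᶠ t in nhds (1 : ℝ), t • v ∈ interior K := by
    apply hc.continuousAt.eventually_mem
    simpa using isOpen_interior.mem_nhds hv
  obtain ⟨ε, hε, hb⟩ := Metric.eventually_nhds_iff.1 hn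
  have h1 := hK _ (interior_subset (hb (y := 1 + ε / 2) (by
    rw [Real.dist_eq, add_sub_cancel_left, abs_of_pos (by positivity)]; linarith)))
  simp only [Pi.smul_apply, smul_eq_mul] at h1
  by_contra! hcon
  nlinarith

/-- lattice points of a set, as pairs -/
def lat (K : Set (Fin 2 → ℝ)) : Set (ℤ × ℤ) := {p | latticeEmbed ![p.1, p.2] ∈ K}

theorem mem_lat {K : Set (Fin 2 → ℝ)} {x y : ℤ} :
    (x, y) ∈ lat K ↔ latticeEmbed ![x, y] ∈ K := Iff.rfl

theorem lat_finite {K : Set (Fin 2 → ℝ)} (R : ℝ) (hR : ∀ z ∈ K, ∀ i, |z i| ≤ R) :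
    (lat K).Finite := by
  refine ((Set.finite_Icc (-⌈R⌉) ⌈R⌉).prod (Set.finite_Icc (-⌈R⌉) ⌈R⌉)).subset ?_
  rintro ⟨x, y⟩ hp
  have h0 := hR _ hp 0
  have h1 := hR _ hp 1
  simp only [latticeEmbed, Matrix.cons_val_zero, Matrix.cons_val_one] at h0 h1
  have e0 : |x| ≤ ⌈R⌉ := by
    have := h0.trans (Int.le_ceil R)
    exact_mod_cast this
  have e1 : |y| ≤ ⌈R⌉ := by
    have := h1.trans (Int.le_ceil R)
    exact_mod_cast this
  exact ⟨abs_le.1 e0, abs_le.1 e1⟩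

theorem frontier_count {K : Set (Fin 2 → ℝ)} (hcl : IsClosed K) (h0 : (0 : Fin 2 → ℝ) ∈ interior K)
    (hfin : (lat K).Finite)
    (hw : ∀ x y : ℤ, (x, y) ∈ lat K → (x, y) ≠ 0 → ∃ X Y : ℤ, x * X + y * Y < 0 ∧
      ∀ z ∈ K, -1 ≤ (X : ℝ) * z 0 + Y * z 1) :
    {p : Fin 2 → ℤ | latticeEmbed p ∈ frontier K}.ncard + 1 = (lat K).ncard := by
  have hz : ((0 : ℤ), (0 : ℤ)) ∈ lat K := by
    rw [mem_lat]
    convert interior_subset h0 using 1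
    ext i
    fin_cases i <;> simp [latticeEmbed]
  have hinj : Function.Injective (fun p : ℤ × ℤ => (![p.1, p.2] : Fin 2 → ℤ)) := by
    rintro ⟨a, b⟩ ⟨c, d⟩ hh
    have h1 := congrFun hh 0
    have h2 := congrFun hh 1
    simp at h1 h2
    simp [h1, h2]
  have e : {p : Fin 2 → ℤ | latticeEmbed p ∈ frontier K} =
      (fun p : ℤ × ℤ => (![p.1, p.2] : Fin 2 → ℤ)) '' (lat K \ {(0, 0)}) := by
    ext p
    simp only [Set.mem_ofPred_eq, Set.mem_image, Set.mem_diff, Set.mem_singleton_iff]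
    constructor
    · intro hp
      have hpp : ![p 0, p 1] = p := by ext i; fin_cases i <;> rfl
      refine ⟨(p 0, p 1), ⟨?_, ?_⟩, hpp⟩
      · rw [mem_lat, hpp]
        exact hcl.frontier_subset hp
      · intro hh
        simp only [Prod.mk.injEq] at hh
        have : latticeEmbed p = 0 := by
          ext i
          fin_cases i <;> simp [latticeEmbed, hh.1, hh.2]
        rw [this] at hp
        exact hp.2 h0
    · rintro ⟨⟨x, y⟩, ⟨h1, h2⟩, rfl⟩
      refine ⟨subset_closure h1, fun hi => ?_⟩
      obtain ⟨X, Y, hlt, hK⟩ := hw x y h1 h2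
      have := interior_strict hi X Y hK
      simp only [latticeEmbed, Matrix.cons_val_zero, Matrix.cons_val_one] at this
      have : (-1 : ℤ) < X * x + Y * y := by exact_mod_cast this
      linarith
  rw [e, Set.ncard_image_of_injective _ hinj]
  exact Set.ncard_diff_singleton_add_one hz hfin

theorem convex_half (a b : ℝ) : Convex ℝ {z : Fin 2 → ℝ | -1 ≤ a * z 0 + b * z 1} := by
  apply convex_halfSpace_ge
  constructor
  · intro x y; simp only [Pi.add_apply]; ring
  · intro c x; simp only [Pi.smul_apply, smul_eq_mul]; ring

/-- The "12 theorem": for a reflexive lattice polygon `Δ` with dual polygon `∇`, the number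
of lattice points on the boundary of `Δ` plus the number of lattice points on the boundary
of `∇` equals 12. -/
theorem stmt2 (Δ : Set (Fin 2 → ℝ)) (hΔ : IsReflexive Δ) :
    {p : Fin 2 → ℤ | latticeEmbed p ∈ frontier Δ}.ncard +
      {p : Fin 2 → ℤ | latticeEmbed p ∈ frontier (dualPolygon Δ)}.ncard = 12 := by
  obtain ⟨⟨⟨S, hS⟩, -⟩, h0, hd⟩ := hΔ
  have hcomp : IsCompact Δ := by
    rw [hS]
    exact (S.finite_toSet.image _).isCompact_convexHull (𝕜 := ℝ)
  have hconv : Convex ℝ Δ := by rw [hS]; exact convex_convexHull _ _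
  have hcl := hcomp.isClosed
  -- bounds
  obtain ⟨R, hRpos, hR⟩ : ∃ R > 0, ∀ z ∈ Δ, ∀ i, |z i| ≤ R := by
    obtain ⟨R, hRp, hR⟩ := hcomp.isBounded.exists_pos_norm_le
    exact ⟨R, hRp, fun z hz i => (norm_le_pi_norm z i).trans (hR z hz)⟩
  obtain ⟨r, hr, hball⟩ : ∃ r > 0, Metric.ball (0 : Fin 2 → ℝ) r ⊆ Δ := by
    obtain ⟨r, hr, h⟩ := Metric.mem_nhds_iff.1 (mem_interior_iff_mem_nhds.1 h0)
    exact ⟨r, hr, h⟩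
  have hbox : ∀ a b : ℝ, |a| < r → |b| < r → ![a, b] ∈ Δ := by
    intro a b ha hb
    apply hball
    rw [mem_ball_zero_iff, pi_norm_lt_iff hr]
    intro i
    fin_cases i
    · simpa using ha
    · simpa using hb
  have hr2 : |r / 2| < r := by rw [abs_of_pos (by positivity)]; linarith
  have hr2' : |-(r / 2)| < r := by rwa [abs_neg]
  have hr0 : |(0 : ℝ)| < r := by simpa using hr
  have hdb : ∀ z ∈ dualPolygon Δ, ∀ i, |z i| ≤ 2 / r := by
    intro z hz i
    have a1 := hz _ (hbox (r / 2) 0 hr2 hr0)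
    have a2 := hz _ (hbox (-(r / 2)) 0 hr2' hr0)
    have a3 := hz _ (hbox 0 (r / 2) hr0 hr2)
    have a4 := hz _ (hbox 0 (-(r / 2)) hr0 hr2')
    simp only [Matrix.cons_val_zero, Matrix.cons_val_one] at a1 a2 a3 a4
    rw [abs_le, neg_le, le_div_iff₀ hr, le_div_iff₀ hr]
    fin_cases i
    · constructor <;> simp <;> linarith
    · constructor <;> simp <;> linarith
  have hdcl : IsClosed (dualPolygon Δ) := by
    have : dualPolygon Δ = ⋂ y ∈ Δ, {x : Fin 2 → ℝ | -1 ≤ x 0 * y 0 + x 1 * y 1} := by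
      ext x; simp [dualPolygon]
    rw [this]
    refine isClosed_biInter fun y _ => isClosed_le (by fun_prop) (by fun_prop)
  have hd0 : (0 : Fin 2 → ℝ) ∈ interior (dualPolygon Δ) := by
    rw [mem_interior_iff_mem_nhds, Metric.mem_nhds_iff]
    refine ⟨1 / (2 * R), by positivity, fun x hx y hy => ?_⟩
    rw [mem_ball_zero_iff, pi_norm_lt_iff (by positivity)] at hx
    have e : ∀ i, |x i * y i| ≤ 1 / 2 := by
      intro i
      rw [abs_mul]
      calc |x i| * |y i| ≤ 1 / (2 * R) * R :=
            mul_le_mul (hx i).le (hR y hy i) (abs_nonneg _) (by positivity)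
        _ = 1 / 2 := by field_simp
    have := (abs_le.1 (e 0)).1
    have := (abs_le.1 (e 1)).1
    linarith
  have hP : Pol (lat Δ) (lat (dualPolygon Δ)) := by
    refine ⟨lat_finite R hR, lat_finite _ hdb, fun x y => ⟨fun hx X Y hX => ?_, fun hx => ?_⟩,
      fun X Y => ⟨fun hX x y hx => ?_, fun hX => ?_⟩⟩
    · have := hX _ hx
      simp only [latticeEmbed, Matrix.cons_val_zero, Matrix.cons_val_one] at this
      have : (-1 : ℤ) ≤ X * x + Y * y := by exact_mod_cast this
      linarith
    · by_contra hnot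
      rw [mem_lat] at hnot
      obtain ⟨f, u, hu1, hu2⟩ := geometric_hahn_banach_point_closed hconv hcl hnot
      have hu0 : u < 0 := by simpa using hu2 0 (interior_subset h0)
      have hf : ∀ z : Fin 2 → ℝ, f z = f ![1, 0] * z 0 + f ![0, 1] * z 1 := by
        intro z
        have : z = z 0 • ![1, 0] + z 1 • ![0, 1] := by
          ext i; fin_cases i <;> simp
        conv_lhs => rw [this]
        rw [map_add, map_smul, map_smul, smul_eq_mul, smul_eq_mul]
        ring
      set a := f ![1, 0]
      set b := f ![0, 1]
      have hin : ![a / (-u), b / (-u)] ∈ dualPolygon Δ := by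
        intro z hz
        have := hu2 z hz
        rw [hf] at this
        simp only [Matrix.cons_val_zero, Matrix.cons_val_one]
        have e : a / (-u) * z 0 + b / (-u) * z 1 = (a * z 0 + b * z 1) / (-u) := by ring
        rw [e, le_div_iff₀ (by linarith)]
        linarith
      rw [hd] at hin
      have hsub : dualPolygon Δ ∩ Set.range latticeEmbed ⊆
          {z : Fin 2 → ℝ | -1 ≤ (x : ℝ) * z 0 + (y : ℝ) * z 1} := by
        rintro _ ⟨hz, p, rfl⟩
        have hpp : ![p 0, p 1] = p := by ext i; fin_cases i <;> rfl
        have := hx (p 0) (p 1) (by rw [mem_lat, hpp]; exact hz)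
        simp only [Set.mem_ofPred_eq, latticeEmbed]
        exact_mod_cast this
      have := convexHull_min hsub (convex_half _ _) hin
      simp only [Set.mem_ofPred_eq, Matrix.cons_val_zero, Matrix.cons_val_one] at this
      have e : x * (a / (-u)) + y * (b / (-u)) = (a * x + b * y) / (-u) := by ring
      rw [e, le_div_iff₀ (by linarith)] at this
      rw [hf] at hu1
      simp only [latticeEmbed, Matrix.cons_val_zero, Matrix.cons_val_one] at hu1
      linarith
    · have := hX _ hx
      simp only [latticeEmbed, Matrix.cons_val_zero, Matrix.cons_val_one] at this
      have : (-1 : ℤ) ≤ X * x + Y * y := by exact_mod_cast this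
      linarith
    · rw [mem_lat]
      intro z hz
      have hSub : latticeEmbed '' (S : Set (Fin 2 → ℤ)) ⊆ Δ := by
        rw [hS]; exact subset_convexHull _ _
      have hsub : latticeEmbed '' (S : Set (Fin 2 → ℤ)) ⊆
          {z : Fin 2 → ℝ | -1 ≤ (X : ℝ) * z 0 + (Y : ℝ) * z 1} := by
        rintro _ ⟨p, hp, rfl⟩
        have hpp : ![p 0, p 1] = p := by ext i; fin_cases i <;> rfl
        have := hX (p 0) (p 1) (by rw [mem_lat, hpp]; exact hSub ⟨p, hp, rfl⟩)
        simp only [Set.mem_ofPred_eq, latticeEmbed]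
        have : (-1 : ℤ) ≤ X * p 0 + Y * p 1 := by linarith
        exact_mod_cast this
      rw [hS] at hz
      have := convexHull_min hsub (convex_half _ _) hz
      simpa [latticeEmbed] using this
  have c1 := frontier_count hcl h0 hP.finA (by
    intro x y _ hne
    obtain ⟨X, Y, hT, hlt⟩ := hP.exT x y hne
    refine ⟨X, Y, hlt, fun z hz => ?_⟩
    simpa [latticeEmbed] using hT z hz)
  have c2 := frontier_count hdcl hd0 hP.finT (by
    intro x y _ hne
    obtain ⟨X, Y, hT, hlt⟩ := hP.exA x y hne
    refine ⟨X, Y, by linarith, fun z hz => ?_⟩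
    have := hz _ hT
    simp only [latticeEmbed, Matrix.cons_val_zero, Matrix.cons_val_one] at this
    linarith)
  have := hP.count
  omega
end

section
/- Let Δ be a reflexive lattice polygon in ℝ² and let ∇ = {x ∈ ℝ² : ⟨x, y⟩ ≥ −1 for all y ∈ Δ} be its dual polygon. Then twice the Euclidean area of Δ plus twice the Euclidean area of ∇ equals 12 (i.e. the sum of the normalized volumes of Δ and ∇ is 12). -/
open MeasureTheory

namespace Twelve

abbrev V := ℤ × ℤ

def nrm (u : V) : ℤ := u.1 * u.1 + u.2 * u.2
def dot (u v : V) : ℤ := u.1 * v.1 + u.2 * v.2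
def dt (u v : V) : ℤ := u.1 * v.2 - u.2 * v.1

def crs (u v : V) : ℤ := if u.2 ≤ 0 ∧ 0 < v.2 then 1 else 0

def FF (u v : V) : ℚ :=
  3 - (dot u v : ℚ) / (nrm u : ℚ) - (dot u v : ℚ) / (nrm v : ℚ) - 12 * (crs u v : ℚ)

def base (v : V) : ℚ :=
  if v = (0, 1) then 3 else if v = (-1, 0) then 6 else if v = (0, -1) then 9 else 12

def isPar (u v : V) : Prop := dt u v = 1 ∧ 0 < dot u v ∧ dot u v < nrm v ∧ nrm u < nrm v

lemma nrm_nonneg (u : V) : 0 ≤ nrm u := by unfold nrm; nlinarith [mul_self_nonneg u.1, mul_self_nonneg u.2]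

open Classical in
noncomputable def Phi (v : V) : ℚ :=
  if h : ∃ u, isPar u v then Phi h.choose + FF h.choose v else base v
termination_by (nrm v).toNat
decreasing_by
  have h1 := h.choose_spec.2.2.2
  have h2 := nrm_nonneg h.choose
  omega

lemma nrm_pos_left {u v : V} (h : dt u v = 1) : 0 < nrm u := by
  rcases (nrm_nonneg u).lt_or_eq with h1 | h1
  · exact h1
  · exfalso
    unfold nrm at h1; unfold dt at h
    have h2 : u.1 = 0 := by nlinarith [mul_self_nonneg u.1, mul_self_nonneg u.2]
    have h3 : u.2 = 0 := by nlinarith [mul_self_nonneg u.1, mul_self_nonneg u.2]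
    simp [h2, h3] at h

lemma nrm_pos_right {u v : V} (h : dt u v = 1) : 0 < nrm v := by
  apply nrm_pos_left (v := (-u.1, -u.2))
  unfold dt at *; simp; linarith

lemma lagr {u v : V} (h : dt u v = 1) : nrm u * nrm v = dot u v ^ 2 + 1 := by
  have : nrm u * nrm v = dot u v ^ 2 + dt u v ^ 2 := by unfold nrm dot dt; ring
  rw [this, h]; ring

lemma par_unique {u u' v : V} (h : isPar u v) (h' : isPar u' v) : u = u' := by
  obtain ⟨a, b, c, -⟩ := h
  obtain ⟨a', b', c', -⟩ := h'
  have hv := nrm_pos_right a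
  have e1 : u.1 * nrm v = dot u v * v.1 + dt u v * v.2 := by unfold dot dt nrm; ring
  have e2 : u.2 * nrm v = dot u v * v.2 - dt u v * v.1 := by unfold dot dt nrm; ring
  have e1' : u'.1 * nrm v = dot u' v * v.1 + dt u' v * v.2 := by unfold dot dt nrm; ring
  have e2' : u'.2 * nrm v = dot u' v * v.2 - dt u' v * v.1 := by unfold dot dt nrm; ring
  -- dot u v - dot u' v is divisible by nrm v
  have key : dot u v - dot u' v = nrm v * dt u' u := by
    have : dt u v * dot u' v = dt u' v * dot u v + dt u u' * nrm v := by
      unfold dot dt nrm; ring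
    rw [a, a'] at this
    have h3 : dt u u' = - dt u' u := by unfold dt; ring
    rw [h3] at this; linarith
  have h0 : dt u' u = 0 := by
    by_contra hne
    rcases lt_or_gt_of_ne hne with h | h
    · nlinarith
    · nlinarith
  rw [h0] at key
  have hd : dot u v = dot u' v := by linarith
  ext
  · apply mul_right_cancel₀ hv.ne'; rw [e1, e1', hd, a, a']
  · apply mul_right_cancel₀ hv.ne'; rw [e2, e2', hd, a, a']

lemma Phi_par {u v : V} (h : isPar u v) : Phi v = Phi u + FF u v := by
  have hex : ∃ u, isPar u v := ⟨u, h⟩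
  rw [Phi, dif_pos hex, par_unique hex.choose_spec h]

lemma Phi_base {v : V} (h : nrm v = 1) : Phi v = base v := by
  rw [Phi, dif_neg]
  rintro ⟨u, -, b, c, -⟩
  omega

lemma crs_add (z v : V) : crs z v = crs z (z + v) + crs (z + v) v := by
  unfold crs
  simp only [Prod.snd_add]
  split_ifs <;> omega

lemma FF_add {z v : V} (h : dt z v = 1) : FF z v = FF z (z + v) + FF (z + v) v := by
  have h1 : (nrm z : ℚ) ≠ 0 := by exact_mod_cast (nrm_pos_left h).ne'
  have h2 : (nrm v : ℚ) ≠ 0 := by exact_mod_cast (nrm_pos_right h).ne'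
  have h3' : dt z (z + v) = 1 := by rw [← h]; unfold dt; simp; ring
  have h3 : (nrm (z + v) : ℚ) ≠ 0 := by exact_mod_cast (nrm_pos_right h3').ne'
  unfold FF
  rw [crs_add z v]
  have e1 : dot z (z + v) = nrm z + dot z v := by unfold dot nrm; simp; ring
  have e2 : dot (z + v) v = nrm v + dot z v := by unfold dot nrm; simp; ring
  have e3 : (nrm (z + v) : ℚ) = nrm z + nrm v + 2 * dot z v := by
    have : nrm (z + v) = nrm z + nrm v + 2 * dot z v := by unfold dot nrm; simp; ring
    exact_mod_cast this
  rw [e1, e2]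
  push_cast
  have k1 : ((nrm z : ℚ) + dot z v) / nrm (z + v) + (nrm v + dot z v) / nrm (z + v) = 1 := by
    rw [← add_div, div_eq_one_iff_eq h3, e3]; ring
  have k2 : ((nrm z : ℚ) + dot z v) / nrm z = 1 + dot z v / nrm z := by
    rw [add_div, div_self h1]
  have k3 : ((nrm v : ℚ) + dot z v) / nrm v = 1 + dot z v / nrm v := by
    rw [add_div, div_self h2]
  linear_combination k1 + k2 + k3

lemma unit_cases {v : V} (h : nrm v = 1) : v = (1,0) ∨ v = (0,1) ∨ v = (-1,0) ∨ v = (0,-1) := by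
  obtain ⟨a, b⟩ := v
  unfold nrm at h
  simp only at h
  have h1 : a ≤ 1 := by nlinarith
  have h2 : -1 ≤ a := by nlinarith
  have h3 : b ≤ 1 := by nlinarith
  have h4 : -1 ≤ b := by nlinarith
  interval_cases a <;> interval_cases b <;> simp_all

lemma FF_acute (n : ℕ) : ∀ u v : V, dt u v = 1 → 0 ≤ dot u v → nrm u < n →
    FF u v = Phi v - Phi u := by
  induction n with
  | zero => intro u v h _ h2; have := nrm_pos_left h; push_cast at h2; omega
  | succ n ih =>
    intro u v h hd hn
    have hu := nrm_pos_left h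
    have hv := nrm_pos_right h
    have hl := lagr h
    rcases hd.lt_or_eq with hd | hd
    · by_cases hc : dot u v < nrm v
      · have : isPar u v := by
          refine ⟨h, hd, hc, ?_⟩
          nlinarith
        rw [Phi_par this]; ring
      · push Not at hc
        have hlt : dot u v < nrm u := by nlinarith
        set z : V := u - v with hz
        have huz : u = z + v := by simp [hz]
        have hzv : dt z v = 1 := by rw [← h, hz]; unfold dt; simp; ring
        have hzu : dt z u = 1 := by rw [← h, hz]; unfold dt; simp; ring
        have hdzu : dot z u = nrm u - dot u v := by rw [hz]; unfold dot nrm; simp; ring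
        have hdzv : dot z v = dot u v - nrm v := by rw [hz]; unfold dot nrm; simp; ring
        have hnz : nrm z = nrm u + nrm v - 2 * dot u v := by rw [hz]; unfold dot nrm; simp; ring
        have hnzu : nrm z < nrm u := by omega
        have hp : isPar z u := ⟨hzu, by omega, by omega, hnzu⟩
        have i1 := ih z v hzv (by omega) (by push_cast at hn; omega)
        have i2 := FF_add hzv
        rw [← huz] at i2
        have i3 := Phi_par hp
        linarith
    · rw [← hd] at hl
      have hu1 : nrm u = 1 := by nlinarith
      have hv1 : nrm v = 1 := by nlinarith
      rw [Phi_base hu1, Phi_base hv1]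
      rcases unit_cases hu1 with rfl | rfl | rfl | rfl <;>
      rcases unit_cases hv1 with rfl | rfl | rfl | rfl <;>
      simp [dt] at h <;> simp [FF, base, dot, nrm, crs] <;> norm_num

lemma FF_eq_aux (n : ℕ) : ∀ u v : V, dt u v = 1 → -(dot u v) < n →
    FF u v = Phi v - Phi u := by
  induction n with
  | zero =>
    intro u v h h2
    push_cast at h2
    have := nrm_nonneg u
    exact FF_acute (nrm u + 1).toNat u v h (by omega) (by omega)
  | succ n ih =>
    intro u v h h2
    have h3 : dt u (u + v) = 1 := by rw [← h]; unfold dt; simp; ring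
    have h4 : dt (u + v) v = 1 := by rw [← h]; unfold dt; simp; ring
    have e1 : dot u (u + v) = nrm u + dot u v := by unfold dot nrm; simp; ring
    have e2 : dot (u + v) v = nrm v + dot u v := by unfold dot nrm; simp; ring
    have hu := nrm_pos_left h
    have hv := nrm_pos_right h
    push_cast at h2
    rw [FF_add h, ih _ _ h3 (by omega), ih _ _ h4 (by omega)]
    ring

lemma FF_eq {u v : V} (h : dt u v = 1) : FF u v = Phi v - Phi u :=
  FF_eq_aux (-(dot u v) + 1).toNat u v h (by omega)

def emb (p : V) : Fin 2 → ℝ := ![(p.1 : ℝ), (p.2 : ℝ)]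

/-- real pairing -/
def pr (q : V) (x : Fin 2 → ℝ) : ℝ := (q.1 : ℝ) * x 0 + (q.2 : ℝ) * x 1

/-- real determinant -/
def rdt (p : V) (x : Fin 2 → ℝ) : ℝ := (p.1 : ℝ) * x 1 - (p.2 : ℝ) * x 0

lemma pr_emb (q p : V) : pr q (emb p) = (dot q p : ℝ) := by simp [pr, emb, dot]
lemma rdt_emb (q p : V) : rdt q (emb p) = (dt q p : ℝ) := by simp [rdt, emb, dt]

structure RP (A B : Set (Fin 2 → ℝ)) (P Q : Finset V) : Prop where
  hullA : A ⊆ convexHull ℝ (emb '' (P : Set V))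
  hullB : B ⊆ convexHull ℝ (emb '' (Q : Set V))
  memA : ∀ x, x ∈ A ↔ ∀ q ∈ Q, -1 ≤ pr q x
  memB : ∀ x, x ∈ B ↔ ∀ p ∈ P, -1 ≤ pr p x
  memP : ∀ p, p ∈ P ↔ ∀ q ∈ Q, -1 ≤ dot q p
  memQ : ∀ q, q ∈ Q ↔ ∀ p ∈ P, -1 ≤ dot p q
  posA : ∀ x, x ≠ 0 → ∃ q ∈ Q, pr q x < 0
  posB : ∀ x, x ≠ 0 → ∃ p ∈ P, pr p x < 0

lemma RP.symm {A B P Q} (h : RP A B P Q) : RP B A Q P :=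
  ⟨h.hullB, h.hullA, h.memB, h.memA, h.memQ, h.memP, h.posB, h.posA⟩

lemma dot_comm (p q : V) : dot p q = dot q p := by unfold dot; ring

lemma emb_ne {p : V} (hp : p ≠ 0) : emb p ≠ 0 := by
  intro h
  apply hp
  have h0 := congrFun h 0
  have h1 := congrFun h 1
  simp [emb] at h0 h1
  ext <;> simp [h0, h1]

section
variable {A B : Set (Fin 2 → ℝ)} {P Q : Finset V}

lemma RP.ge (h : RP A B P Q) {p q : V} (hp : p ∈ P) (hq : q ∈ Q) : -1 ≤ dot q p := (h.memP p).1 hp q hq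

lemma RP.exQ (h : RP A B P Q) {p : V} (hp : p ∈ P) (h0 : p ≠ 0) : ∃ q ∈ Q, dot q p = -1 := by
  obtain ⟨q, hq, hlt⟩ := h.posA (emb p) (emb_ne h0)
  refine ⟨q, hq, ?_⟩
  rw [pr_emb] at hlt
  have := h.ge hp hq
  have : dot q p < 0 := by exact_mod_cast hlt
  omega

lemma RP.exP (h : RP A B P Q) {q : V} (hp : q ∈ Q) (h0 : q ≠ 0) : ∃ p ∈ P, dot q p = -1 := by
  obtain ⟨p, hp, hpq⟩ := h.symm.exQ hp h0
  exact ⟨p, hp, by rw [dot_comm]; exact hpq⟩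

/-- Lexicographic halfplanes are convex. -/
lemma lex_convex (q p : V) (β : ℝ) :
    Convex ℝ {z : Fin 2 → ℝ | -1 < pr q z ∨ (pr q z = -1 ∧ rdt p z < β)} := by
  intro x hx y hy a b ha hb hab
  have e1 : pr q (a • x + b • y) = a * pr q x + b * pr q y := by
    simp [pr]; ring
  have e2 : rdt p (a • x + b • y) = a * rdt p x + b * rdt p y := by
    simp [rdt]; ring
  simp only [Set.mem_ofPred_eq] at *
  rw [e1, e2]
  obtain rfl : b = 1 - a := by linarith
  rcases ha.lt_or_eq with ha | rfl
  · rcases hb.lt_or_eq with hb | hb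
    · rcases hx with hx | ⟨hx, hx'⟩ <;> rcases hy with hy | ⟨hy, hy'⟩
      · left; nlinarith
      · left; nlinarith
      · left; nlinarith
      · right; constructor
        · rw [hx, hy]; ring
        · nlinarith
    · obtain rfl : a = 1 := by linarith
      simpa using hx
  · simpa using hy

lemma RP.face_ge (h : RP A B P Q) {q p0 : V} (hq : q ∈ Q) {x : Fin 2 → ℝ} (hx : x ∈ A)
    (hqx : pr q x = -1) : ∃ y ∈ P, dot q y = -1 ∧ rdt p0 x ≤ (dt p0 y : ℝ) := by
  by_contra hcon
  push Not at hcon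
  have hsub : convexHull ℝ (emb '' (P : Set V)) ⊆
      {z : Fin 2 → ℝ | -1 < pr q z ∨ (pr q z = -1 ∧ rdt p0 z < rdt p0 x)} := by
    apply convexHull_min _ (lex_convex _ _ _)
    rintro _ ⟨y, hy, rfl⟩
    simp only [Set.mem_ofPred_eq, pr_emb, rdt_emb]
    rcases (h.ge hy hq).lt_or_eq with h1 | h1
    · left; exact_mod_cast h1
    · right; exact ⟨by exact_mod_cast h1.symm, hcon y hy h1.symm⟩
  have := hsub (h.hullA hx)
  simp [hqx] at this

lemma RP.face_le (h : RP A B P Q) {q p0 : V} (hq : q ∈ Q) {x : Fin 2 → ℝ} (hx : x ∈ A)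
    (hqx : pr q x = -1) : ∃ y ∈ P, dot q y = -1 ∧ (dt p0 y : ℝ) ≤ rdt p0 x := by
  obtain ⟨y, hy, h1, h2⟩ := h.face_ge (p0 := -p0) hq hx hqx
  refine ⟨y, hy, h1, ?_⟩
  have e1 : dt (-p0) y = - dt p0 y := by simp [dt]; ring
  have e2 : rdt (-p0) x = - rdt p0 x := by simp [rdt]; ring
  rw [e1, e2] at h2
  push_cast at h2
  linarith

/-- direction of the edge dual to `q`, counterclockwise -/
def rq (q : V) : V := (q.2, -q.1)

lemma on_line {q p y : V} (hp : dot q p = -1) (hy : dot q y = -1) : y = p + dt p y • rq q := by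
  unfold dot at hp hy
  ext
  · simp [dt, rq]
    linear_combination y.1 * hp - p.1 * hy
  · simp [dt, rq]
    linear_combination y.2 * hp - p.2 * hy

lemma RP.interp (h : RP A B P Q) {p r : V} {s m t : ℤ} (h1 : p + s • r ∈ P) (h2 : p + t • r ∈ P)
    (hs : s ≤ m) (ht : m ≤ t) : p + m • r ∈ P := by
  rw [h.memP] at *
  intro q hq
  have a1 := h1 q hq
  have a2 := h2 q hq
  have e : ∀ k : ℤ, dot q (p + k • r) = dot q p + k * dot q r := by intro k; simp [dot]; ring
  rw [e] at *
  rcases le_total 0 (dot q r) with h3 | h3 <;> nlinarith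

lemma basis {u v : V} (h : dt u v = 1) (x : V) : x = dt x v • u + dt u x • v := by
  unfold dt at *
  ext
  · simp; linear_combination (-x.1) * h
  · simp; linear_combination (-x.2) * h

lemma RP.uniq (h : RP A B P Q) {p s s' w w' : V} (hs : s ∈ P) (hs' : s' ∈ P)
    (hw : w ∈ Q) (hw' : w' ∈ Q) (d : dt p s = 1) (d' : dt p s' = 1) (a1 : dot w p = -1)
    (a2 : dot w s = -1) (b1 : dot w' p = -1) (b2 : dot w' s' = -1) : s = s' := by
  have e := basis d s'
  rw [d', one_smul] at e
  have i1 := h.ge hs' hw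
  have i2 := h.ge hs hw'
  set m := dt s' s
  have e1 : dot w s' = m * dot w p + dot w s := by rw [e]; simp [dot]; ring
  have e2 : dot w' s' = m * dot w' p + dot w' s := by rw [e]; simp [dot]; ring
  have : m = 0 := by
    rw [a1] at e1; rw [b1] at e2; omega
  rw [e, this]; simp

lemma RP.inj (h : RP A B P Q) {p p' s w w' : V} (hp : p ∈ P) (hp' : p' ∈ P)
    (hw : w ∈ Q) (hw' : w' ∈ Q) (d : dt p s = 1) (d' : dt p' s = 1) (a1 : dot w p = -1)
    (a2 : dot w s = -1) (b1 : dot w' p' = -1) (b2 : dot w' s = -1) : p = p' := by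
  have e := basis d p'
  rw [d', one_smul] at e
  have i1 := h.ge hp' hw
  have i2 := h.ge hp hw'
  set m := dt p p'
  have e1 : dot w p' = dot w p + m * dot w s := by rw [e]; simp [dot]; ring
  have e2 : dot w' p' = dot w' p + m * dot w' s := by rw [e]; simp [dot]; ring
  have : m = 0 := by
    rw [a2] at e1; rw [b2] at e2; omega
  rw [e, this]; simp

lemma dt_add_rq {q p : V} (h : dot q p = -1) : dt p (p + rq q) = 1 := by
  unfold dot at h; simp [dt, rq]; linear_combination - h

lemma dot_add_rq {q p : V} (h : dot q p = -1) : dot q (p + rq q) = -1 := by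
  unfold dot at *; simp [rq]; linear_combination h

lemma RP.exNext (h : RP A B P Q) {p : V} (hp : p ∈ P) (h0 : p ≠ 0) :
    ∃ s ∈ P, dt p s = 1 ∧ ∃ w ∈ Q, dot w p = -1 ∧ dot w s = -1 := by
  obtain ⟨q0, hq0, hq0'⟩ := h.exQ hp h0
  obtain ⟨w, hw, hmax⟩ := (Q.filter (fun q => dot q p = -1)).exists_max_image
    (fun q => dot q (rq p)) ⟨q0, by simp [hq0, hq0']⟩
  simp only [Finset.mem_filter, and_imp] at hw hmax
  obtain ⟨hw, hwp⟩ := hw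
  have key : ∀ q ∈ Q, dot q p = -1 → 0 ≤ dot q (rq w) := by
    intro q hq hqp
    have h1 := hmax q hq hqp
    have h2 := on_line (q := p) (p := w) (y := q) (by rw [dot_comm]; exact hwp)
      (by rw [dot_comm]; exact hqp)
    have h3 : dot q (rq p) = dot w (rq p) + dt w q * nrm p := by
      conv_lhs => rw [h2]
      simp [dot, rq, nrm]; ring
    have h4 : dot q (rq w) = - dt w q := by simp [dot, rq, dt]; ring
    have h5 : 0 < nrm p := by
      rcases (nrm_nonneg p).lt_or_eq with h6 | h6
      · exact h6
      · exfalso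
        apply h0
        unfold nrm at h6
        ext
        · simp; nlinarith [mul_self_nonneg p.1, mul_self_nonneg p.2]
        · simp; nlinarith [mul_self_nonneg p.1, mul_self_nonneg p.2]
    rw [h4]
    nlinarith
  obtain ⟨N, hN1, hN⟩ : ∃ N : ℤ, 1 ≤ N ∧ ∀ q ∈ Q, -N ≤ dot q (rq w) := by
    refine ⟨1 + ∑ q ∈ Q, |dot q (rq w)|, ?_, ?_⟩
    · have := Finset.sum_nonneg (s := Q) (f := fun q => |dot q (rq w)|) (fun q _ => abs_nonneg _)
      linarith
    · intro q hq
      have := Finset.single_le_sum (s := Q) (f := fun q => |dot q (rq w)|)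
        (fun q _ => abs_nonneg _) hq
      have := neg_abs_le (dot q (rq w))
      linarith
  have hNr : (0 : ℝ) < N := by exact_mod_cast (by omega : 0 < N)
  set x : Fin 2 → ℝ := emb p + (1 / (N : ℝ)) • emb (rq w) with hx
  have hpx : ∀ q, pr q x = dot q p + (dot q (rq w) : ℝ) / N := by
    intro q
    rw [← pr_emb, ← pr_emb]
    simp [hx, pr]; field_simp
    ring
  have hxA : x ∈ A := by
    rw [h.memA]
    intro q hq
    rw [hpx]
    have h1 := h.ge hp hq
    rcases h1.lt_or_eq with h1 | h1
    · have h2 : (0 : ℝ) ≤ dot q p := by exact_mod_cast (by omega : 0 ≤ dot q p)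
      have h3 : (-1 : ℝ) ≤ (dot q (rq w) : ℝ) / N := by
        rw [le_div_iff₀ hNr]
        have := hN q hq
        have : ((-N : ℤ) : ℝ) ≤ dot q (rq w) := by exact_mod_cast this
        push_cast at this
        linarith
      linarith
    · have h2 : (0 : ℝ) ≤ (dot q (rq w) : ℝ) / N := by
        apply div_nonneg _ hNr.le
        exact_mod_cast key q hq h1.symm
      have h3 : (dot q p : ℝ) = -1 := by rw [← h1]; norm_num
      linarith
  have hwx : pr w x = -1 := by
    rw [hpx, hwp]
    have : dot w (rq w) = 0 := by simp [dot, rq]; ring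
    simp [this]
  obtain ⟨y, hy, hwy, hge⟩ := h.face_ge (p0 := p) hw hxA hwx
  have hb : rdt p x = 1 / N := by
    have e : rdt p x = dt p p + (dt p (rq w) : ℝ) / N := by
      rw [← rdt_emb, ← rdt_emb]; simp [hx, rdt]; field_simp; ring
    have e1 : dt p p = 0 := by unfold dt; ring
    have e2 : dt p (rq w) = 1 := by rw [show dt p (rq w) = - dot w p by simp [dt, rq, dot]; ring, hwp]; rfl
    rw [e, e1, e2]; simp
  have hpos : 0 < dt p y := by
    have : (0 : ℝ) < dt p y := by
      have : (0 : ℝ) < 1 / N := by positivity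
      linarith
    exact_mod_cast this
  have hl := on_line hwp hwy
  refine ⟨p + rq w, ?_, dt_add_rq hwp, w, hw, hwp, dot_add_rq hwp⟩
  have := h.interp (p := p) (r := rq w) (s := 0) (m := 1) (t := dt p y) (by simpa using hp)
    (by rw [← hl]; exact hy) (by norm_num) (by omega)
  simpa using this

end

structure Nx (P Q : Finset V) (σ ω : V → V) : Prop where
  mem : ∀ p ∈ P.erase 0, σ p ∈ P.erase 0
  det : ∀ p ∈ P.erase 0, dt p (σ p) = 1
  omem : ∀ p ∈ P.erase 0, ω p ∈ Q
  o1 : ∀ p ∈ P.erase 0, dot (ω p) p = -1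
  o2 : ∀ p ∈ P.erase 0, dot (ω p) (σ p) = -1

section
variable {A B : Set (Fin 2 → ℝ)} {P Q : Finset V} {σ ω : V → V}

lemma ne_zero_of_dot {q p : V} (h : dot q p = -1) : p ≠ 0 := by
  rintro rfl
  simp [dot] at h

lemma RP.exNx (h : RP A B P Q) : ∃ σ ω, Nx P Q σ ω := by
  have H : ∀ p : V, ∃ s w : V, p ∈ P.erase 0 →
      (s ∈ P.erase 0 ∧ dt p s = 1 ∧ w ∈ Q ∧ dot w p = -1 ∧ dot w s = -1) := by
    intro p
    by_cases hp : p ∈ P.erase 0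
    · have hp' := Finset.mem_erase.1 hp
      obtain ⟨s, hs, d, w, hw, h1, h2⟩ := h.exNext hp'.2 hp'.1
      exact ⟨s, w, fun _ => ⟨Finset.mem_erase.2 ⟨ne_zero_of_dot h2, hs⟩, d, hw, h1, h2⟩⟩
    · exact ⟨0, 0, fun h => absurd h hp⟩
  choose σ ω H using H
  exact ⟨σ, ω, fun p hp => (H p hp).1, fun p hp => (H p hp).2.1, fun p hp => (H p hp).2.2.1,
    fun p hp => (H p hp).2.2.2.1, fun p hp => (H p hp).2.2.2.2⟩

lemma RP.reindex (h : RP A B P Q) (n : Nx P Q σ ω) {M : Type*} [AddCommMonoid M] (g : V → M) :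
    ∑ p ∈ P.erase 0, g (σ p) = ∑ p ∈ P.erase 0, g p := by
  classical
  have hinj : Set.InjOn σ (P.erase 0 : Finset V) := by
    intro p hp p' hp' e
    have hp := Finset.mem_coe.1 hp
    have hp' := Finset.mem_coe.1 hp'
    have d' := n.det p' hp'
    have o' := n.o2 p' hp'
    rw [← e] at d' o'
    exact h.inj (Finset.mem_of_mem_erase hp) (Finset.mem_of_mem_erase hp') (n.omem p hp)
      (n.omem p' hp') (n.det p hp) d' (n.o1 p hp) (n.o2 p hp) (n.o1 p' hp') o'
  have him : (P.erase 0).image σ = P.erase 0 := by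
    apply Finset.eq_of_subset_of_card_le
    · intro x hx
      obtain ⟨p, hp, rfl⟩ := Finset.mem_image.1 hx
      exact n.mem p hp
    · rw [Finset.card_image_of_injOn hinj]
  conv_rhs => rw [← him]
  rw [Finset.sum_image hinj]

/-- If two lattice points of an edge, `p` before `y`, then the next one after `p` is on the edge. -/
lemma RP.next_eq (h : RP A B P Q) (n : Nx P Q σ ω) {p y q : V} (hp : p ∈ P) (hy : y ∈ P) (hq : q ∈ Q)
    (h1 : dot q p = -1) (h2 : dot q y = -1) (hd : 0 < dt p y) : σ p = p + rq q := by
  have hpe : p ∈ P.erase 0 := Finset.mem_erase.2 ⟨ne_zero_of_dot h1, hp⟩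
  have hl := on_line h1 h2
  have hm := h.interp (p := p) (r := rq q) (s := 0) (m := 1) (t := dt p y) (by simpa using hp)
    (by rw [← hl]; exact hy) (by norm_num) (by omega)
  rw [one_smul] at hm
  exact h.uniq (Finset.mem_of_mem_erase (n.mem p hpe)) hm (n.omem p hpe) hq (n.det p hpe)
    (dt_add_rq h1) (n.o1 p hpe) (n.o2 p hpe) h1 (dot_add_rq h1)

lemma RP.last_exists (h : RP A B P Q) (n : Nx P Q σ ω) {q : V} (hq : q ∈ Q.erase 0) :
    ∃ p ∈ P.erase 0, dot q p = -1 ∧ 0 ≤ dot q (σ p) := by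
  obtain ⟨hq0, hq⟩ := Finset.mem_erase.1 hq
  obtain ⟨p0, hp0, hqp0⟩ := h.exP hq hq0
  obtain ⟨p, hp, hmax⟩ := (P.filter (fun p => dot q p = -1)).exists_max_image
    (fun p => dot p (rq q)) ⟨p0, by simp [hp0, hqp0]⟩
  simp only [Finset.mem_filter, and_imp] at hp hmax
  obtain ⟨hp, hqp⟩ := hp
  have hpe : p ∈ P.erase 0 := Finset.mem_erase.2 ⟨ne_zero_of_dot hqp, hp⟩
  refine ⟨p, hpe, hqp, ?_⟩
  by_contra hneg
  have hs := Finset.mem_of_mem_erase (n.mem p hpe)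
  have h1 := h.ge hs hq
  have h2 : dot q (σ p) = -1 := by omega
  have h3 := hmax _ hs h2
  have h4 := on_line hqp h2
  rw [n.det p hpe, one_smul] at h4
  rw [h4] at h3
  have h5 : dot (p + rq q) (rq q) = dot p (rq q) + nrm q := by simp [dot, rq, nrm]; ring
  have h6 : 0 < nrm q := by
    have := nrm_pos_right (dt_add_rq hqp)
    rcases (nrm_nonneg q).lt_or_eq with h6 | h6
    · exact h6
    · exfalso
      apply hq0
      unfold nrm at h6
      ext
      · simp; nlinarith [mul_self_nonneg q.1, mul_self_nonneg q.2]
      · simp; nlinarith [mul_self_nonneg q.1, mul_self_nonneg q.2]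
  omega

lemma RP.last_unique (h : RP A B P Q) (n : Nx P Q σ ω) {q : V} (hq : q ∈ Q) {p p' : V}
    (hp : p ∈ P) (hp' : p' ∈ P) (h1 : dot q p = -1) (h2 : 0 ≤ dot q (σ p))
    (h1' : dot q p' = -1) (h2' : 0 ≤ dot q (σ p')) : p = p' := by
  have hl := on_line h1 h1'
  rcases lt_trichotomy (dt p p') 0 with hd | hd | hd
  · have hd' : 0 < dt p' p := by
      have : dt p' p = - dt p p' := by unfold dt; ring
      omega
    rw [h.next_eq n hp' hp hq h1' h1 hd', dot_add_rq h1'] at h2'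
    omega
  · rw [hl, hd]; simp
  · rw [h.next_eq n hp hp' hq h1 h1' hd, dot_add_rq h1] at h2
    omega

/-- number of points on dual edges -/
lemma RP.fiber (h : RP A B P Q) (n : Nx P Q σ ω) {p : V} (hp : p ∈ P.erase 0) :
    (((Q.erase 0).filter (fun q => dot q (σ p) = -1 ∧ 0 ≤ dot q (σ (σ p)))).card : ℤ)
      = 2 - dt p (σ (σ p)) := by
  set s := σ p with hs
  set t := σ s with ht
  have hsm : s ∈ P.erase 0 := n.mem p hp
  have htm : t ∈ P.erase 0 := n.mem s hsm
  have d1 : dt p s = 1 := n.det p hp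
  have d2 : dt s t = 1 := n.det s hsm
  set a := dt p t with ha
  have hpe : p = a • s - t := by
    have := basis d1 t
    have e : dt t s = -1 := by rw [← d2]; unfold dt; ring
    rw [e] at this
    rw [← ha] at this
    rw [this]; simp
  have ex : ∀ q, dot q p = a * dot q s - dot q t := by
    intro q; rw [hpe]; simp [dot]; ring
  have hw := n.omem s hsm
  have hw' := n.omem p hp
  have w1 : dot (ω s) s = -1 := n.o1 s hsm
  have w2 : dot (ω s) t = -1 := n.o2 s hsm
  have w1' : dot (ω p) s = -1 := n.o2 p hp
  have w2' : dot (ω p) p = -1 := n.o1 p hp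
  have w3 : dot (ω p) t = 1 - a := by have := ex (ω p); rw [w1', w2'] at this; linarith
  have ha2 : a ≤ 2 := by
    have := h.ge (Finset.mem_of_mem_erase htm) hw'
    omega
  have hcard : (((Q.erase 0).filter (fun q => dot q s = -1 ∧ 0 ≤ dot q t)).card)
      = (Finset.Icc (0 : ℤ) (1 - a)).card := by
    apply Finset.card_bij (fun q _ => dot q t)
    · intro q hq
      simp only [Finset.mem_filter, Finset.mem_erase] at hq
      obtain ⟨⟨hq0, hq⟩, h1, h2⟩ := hq
      have h3 := h.ge (Finset.mem_of_mem_erase hp) hq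
      rw [ex, h1] at h3
      rw [Finset.mem_Icc]
      constructor <;> omega
    · intro q hq q' hq' e
      simp only [Finset.mem_filter, Finset.mem_erase] at hq hq'
      have e1 : dot q s = dot q' s := by rw [hq.2.1, hq'.2.1]
      unfold dot at e e1
      unfold dt at d2
      ext
      · linear_combination (-(q.1 - q'.1)) * d2 + t.2 * e1 - s.2 * e
      · linear_combination (-(q.2 - q'.2)) * d2 - t.1 * e1 + s.1 * e
    · intro k hk
      rw [Finset.mem_Icc] at hk
      have key : ∃ q : V, dot q s = -1 ∧ dot q t = k := by
        refine ⟨(-t.2 - k * s.2, t.1 + k * s.1), ?_, ?_⟩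
        · unfold dot; unfold dt at d2; simp; linear_combination - d2
        · unfold dot; unfold dt at d2; simp; linear_combination k * d2
      obtain ⟨q, hqs, hqt⟩ := key
      refine ⟨q, ?_, hqt⟩
      simp only [Finset.mem_filter, Finset.mem_erase]
      refine ⟨⟨?_, ?_⟩, hqs, by omega⟩
      · apply ne_zero_of_dot (q := s); rw [dot_comm]; exact hqs
      · rw [h.memQ]
        intro y hy
        rw [dot_comm]
        have i1 := h.ge hy hw
        have i2 := h.ge hy hw'
        have ey := basis d2 y
        have f : ∀ z, dot z y = dt y t * dot z s + dt s y * dot z t := by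
          intro z
          conv_lhs => rw [ey]
          simp [dot]; ring
        have hc : (2 - a) * dot q y = (1 - a - k) * dot (ω s) y + (k + 1) * dot (ω p) y := by
          rw [f q, f (ω s), f (ω p), hqs, hqt, w1, w2, w1', w3]; ring
        have hpos : 0 < 2 - a := by omega
        have : (2 - a) * (-1) ≤ (2 - a) * dot q y := by
          rw [hc]; nlinarith
        exact le_of_mul_le_mul_left this hpos
  rw [hcard, Int.card_Icc]
  omega

lemma RP.cardQ (h : RP A B P Q) (n : Nx P Q σ ω) :
    ((Q.erase 0).card : ℤ) = ∑ p ∈ P.erase 0, (2 - dt p (σ (σ p))) := by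
  classical
  have H : ∀ q : V, ∃ p, q ∈ Q.erase 0 → (p ∈ P.erase 0 ∧ dot q p = -1 ∧ 0 ≤ dot q (σ p)) := by
    intro q
    by_cases hq : q ∈ Q.erase 0
    · obtain ⟨p, h1, h2⟩ := h.last_exists n hq
      exact ⟨p, fun _ => ⟨h1, h2⟩⟩
    · exact ⟨0, fun h => absurd h hq⟩
  choose g hg using H
  have h1 := Finset.card_eq_sum_card_fiberwise (f := g) (s := Q.erase 0) (t := P.erase 0)
    (fun q hq => (hg q hq).1)
  rw [h1]
  push_cast
  rw [← h.reindex n]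
  apply Finset.sum_congr rfl
  intro p hp
  rw [← h.fiber n hp]
  congr 2
  apply Finset.filter_congr
  intro q hq
  constructor
  · intro e; rw [← e]; exact (hg q hq).2
  · intro e
    exact h.last_unique n (Finset.mem_of_mem_erase hq) (Finset.mem_of_mem_erase (hg q hq).1)
      (Finset.mem_of_mem_erase (n.mem p hp)) (hg q hq).2.1 (hg q hq).2.2 e.1 e.2

/-- coordinates in a cone -/
lemma rbasis {u v : V} (h : dt u v = 1) (q : V) (x : Fin 2 → ℝ) :
    pr q x = (- rdt v x) * dot q u + rdt u x * dot q v := by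
  have h' : (u.1 : ℝ) * v.2 - u.2 * v.1 = 1 := by unfold dt at h; exact_mod_cast h
  unfold pr rdt dot
  push_cast
  linear_combination (-(q.1 * x 0 + q.2 * x 1)) * h'

lemma rbasis_dt {u v : V} (h : dt u v = 1) (q : V) (x : Fin 2 → ℝ) :
    rdt q x = (- rdt v x) * dt q u + rdt u x * dt q v := by
  have h' : (u.1 : ℝ) * v.2 - u.2 * v.1 = 1 := by unfold dt at h; exact_mod_cast h
  unfold rdt dt
  push_cast
  linear_combination (-(q.1 * x 1 - q.2 * x 0)) * h'

lemma RP.cone_exists (h : RP A B P Q) (n : Nx P Q σ ω) {x : Fin 2 → ℝ} (hx : x ≠ 0) :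
    ∃ p ∈ P.erase 0, 0 ≤ rdt p x ∧ 0 < - rdt (σ p) x := by
  obtain ⟨q0, hq0, hlt⟩ := h.posA x hx
  obtain ⟨q, hq, hmin⟩ := Q.exists_min_image (fun q => pr q x) ⟨q0, hq0⟩
  have hneg : pr q x < 0 := lt_of_le_of_lt (hmin q0 hq0) hlt
  obtain ⟨l, hl, hl0⟩ : ∃ l : ℝ, pr q x = -l ∧ 0 < l := ⟨- pr q x, by ring, by linarith⟩
  set x' : Fin 2 → ℝ := (1 / l) • x with hx'
  have ep : ∀ z, pr z x' = pr z x / l := by intro z; simp [pr, hx']; field_simp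
  have ed : ∀ z, rdt z x = l * rdt z x' := by intro z; simp [rdt, hx']; field_simp
  have hxA : x' ∈ A := by
    rw [h.memA]
    intro z hz
    rw [ep, le_div_iff₀ hl0]
    have := hmin z hz
    linarith
  have hqx : pr q x' = -1 := by rw [ep, hl]; field_simp
  have hq0 : q ≠ 0 := by rintro rfl; simp [pr] at hneg
  obtain ⟨p0, hp0, hqp0⟩ := h.exP hq hq0
  obtain ⟨y1, hy1, hqy1, hle⟩ := h.face_le (p0 := p0) hq hxA hqx
  obtain ⟨y2, hy2, hqy2, hge⟩ := h.face_ge (p0 := p0) hq hxA hqx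
  have l1 := on_line hqp0 hqy1
  have l2 := on_line hqp0 hqy2
  set β := rdt p0 x' with hβ
  set m := ⌊β⌋ with hm
  have hm1 : dt p0 y1 ≤ m := Int.le_floor.2 hle
  have hm2 : m ≤ dt p0 y2 := by
    have : (m : ℝ) ≤ dt p0 y2 := (Int.floor_le β).trans hge
    exact_mod_cast this
  have hp : p0 + m • rq q ∈ P := h.interp (by rw [← l1]; exact hy1) (by rw [← l2]; exact hy2) hm1 hm2
  set p := p0 + m • rq q with hpdef
  have hqp : dot q p = -1 := by
    rw [← hqp0, hpdef]; simp [dot, rq]; ring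
  have hpe : p ∈ P.erase 0 := Finset.mem_erase.2 ⟨ne_zero_of_dot hqp, hp⟩
  have hrp : rdt p x' = β - m := by
    have : rdt p x' = β + m * pr q x' := by
      simp [hpdef, hβ, rdt, pr, rq]; ring
    rw [this, hqx]; ring
  refine ⟨p, hpe, ?_, ?_⟩
  · rw [ed, hrp]
    have := Int.floor_le β
    apply mul_nonneg hl0.le
    linarith
  · rw [ed]
    have hgoal : 0 < - rdt (σ p) x' := by
      rcases (Int.floor_le β).lt_or_eq with hlt | heq
      · have hd : dt p y2 = dt p0 y2 - m := by
          have : dt p y2 = dt p0 y2 + m * dot q y2 := by simp [hpdef, dt, dot, rq]; ring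
          rw [this, hqy2]; ring
        have hlt2 : m < dt p0 y2 := by
          have : (m : ℝ) < dt p0 y2 := lt_of_lt_of_le hlt hge
          exact_mod_cast this
        rw [h.next_eq n hp hy2 hq hqp hqy2 (by omega)]
        have : rdt (p + rq q) x' = rdt p x' + pr q x' := by simp [rdt, pr, rq]; ring
        rw [this, hrp, hqx]
        have := Int.lt_floor_add_one β
        linarith
      · have h0 : rdt p x' = 0 := by rw [hrp, ← heq, ← hm]; ring
        have := rbasis (n.det p hpe) q x'
        rw [h0, hqx, hqp] at this
        push_cast at this
        linarith
    nlinarith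

lemma RP.cone_unique (h : RP A B P Q) (n : Nx P Q σ ω) {x : Fin 2 → ℝ} {p p' : V}
    (hp : p ∈ P.erase 0) (hp' : p' ∈ P.erase 0) (h1 : 0 ≤ rdt p x) (h2 : 0 < - rdt (σ p) x)
    (h1' : 0 ≤ rdt p' x) (h2' : 0 < - rdt (σ p') x) : p = p' := by
  have main : ∀ u v : V, u ∈ P.erase 0 → v ∈ P.erase 0 → pr (ω u) x = - (- rdt (σ u) x + rdt u x) ∧
      pr (ω u) x = (- rdt (σ v) x) * dot (ω u) v + rdt v x * dot (ω u) (σ v) ∧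
      (-1 : ℝ) ≤ dot (ω u) v ∧ (-1 : ℝ) ≤ dot (ω u) (σ v) := by
    intro u v hu hv
    refine ⟨?_, rbasis (n.det v hv) _ _, ?_, ?_⟩
    · rw [rbasis (n.det u hu), n.o1 u hu, n.o2 u hu]; push_cast; ring
    · exact_mod_cast h.ge (Finset.mem_of_mem_erase hv) (n.omem u hu)
    · exact_mod_cast h.ge (Finset.mem_of_mem_erase (n.mem v hv)) (n.omem u hu)
  obtain ⟨a1, a2, a3, a4⟩ := main p p' hp hp'
  obtain ⟨b1, b2, b3, b4⟩ := main p' p hp' hp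
  have hdet' := rbasis_dt (n.det p' hp') p x
  set a := - rdt (σ p) x
  set b := rdt p x
  set a' := - rdt (σ p') x
  set b' := rdt p' x
  have hsum : a + b = a' + b' := by
    apply le_antisymm
    · nlinarith
    · nlinarith
  have hz : a' * (dot (ω p) p' + 1) + b' * (dot (ω p) (σ p') + 1) = 0 := by linarith
  have z1 : 0 ≤ a' * ((dot (ω p) p' : ℝ) + 1) := mul_nonneg h2'.le (by linarith)
  have z2 : 0 ≤ b' * ((dot (ω p) (σ p') : ℝ) + 1) := mul_nonneg h1' (by linarith)
  have z3 : a' * ((dot (ω p) p' : ℝ) + 1) = 0 := by linarith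
  have z4 : b' * ((dot (ω p) (σ p') : ℝ) + 1) = 0 := by linarith
  have hwp' : dot (ω p) p' = -1 := by
    rcases mul_eq_zero.1 z3 with h | h
    · linarith
    · have : (dot (ω p) p' : ℝ) = -1 := by linarith
      exact_mod_cast this
  have hl := on_line (n.o1 p hp) hwp'
  have hb : b = (a' + b') * dt p p' + b' := by
    rcases mul_eq_zero.1 z4 with h | h
    · rw [hdet', h]; ring
    · have h5 : dot (ω p) (σ p') = -1 := by
        have : (dot (ω p) (σ p') : ℝ) = -1 := by linarith
        exact_mod_cast this
      have h6 := on_line hwp' h5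
      rw [n.det p' hp', one_smul] at h6
      have h7 : dt p (σ p') = dt p p' + 1 := by
        have : dt p (p' + rq (ω p)) = dt p p' - dot (ω p) p := by simp [dt, dot, rq]; ring
        rw [h6, this, n.o1 p hp]; ring
      rw [hdet', h7]; push_cast; ring
  have ht : dt p p' = 0 := by
    by_contra hne
    rcases lt_or_gt_of_ne hne with h | h
    · have : (dt p p' : ℝ) ≤ -1 := by exact_mod_cast (by omega : dt p p' ≤ -1)
      nlinarith
    · have : (1 : ℝ) ≤ dt p p' := by exact_mod_cast (by omega : 1 ≤ dt p p')
      nlinarith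
  rw [hl, ht]; simp

lemma RP.sum_crs (h : RP A B P Q) (n : Nx P Q σ ω) :
    ∑ p ∈ P.erase 0, crs p (σ p) = 1 := by
  classical
  have hx : emb (1, 0) ≠ 0 := emb_ne (by simp)
  have e : ∀ z : V, rdt z (emb (1, 0)) = - (z.2 : ℝ) := by intro z; simp [rdt, emb]
  obtain ⟨p, hp, h1, h2⟩ := h.cone_exists n hx
  rw [Finset.sum_eq_single_of_mem p hp]
  · rw [e] at h1 h2
    unfold crs
    rw [if_pos]
    constructor
    · have : (p.2 : ℝ) ≤ 0 := by linarith
      exact_mod_cast this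
    · have : (0 : ℝ) < (σ p).2 := by linarith
      exact_mod_cast this
  · intro p' hp' hne
    unfold crs
    rw [if_neg]
    rintro ⟨c1, c2⟩
    apply hne
    refine h.cone_unique n hp' hp (x := emb (1, 0)) ?_ ?_ h1 h2
    · rw [e]
      have : (p'.2 : ℝ) ≤ 0 := by exact_mod_cast c1
      linarith
    · rw [e]
      have : (0 : ℝ) < (σ p').2 := by exact_mod_cast c2
      linarith

lemma RP.sum12 (h : RP A B P Q) (n : Nx P Q σ ω) :
    ∑ p ∈ P.erase 0, (3 - dt p (σ (σ p))) = 12 := by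
  have h1 : ∑ p ∈ P.erase 0, FF p (σ p) = 0 := by
    rw [Finset.sum_congr rfl (fun p hp => FF_eq (n.det p hp)), Finset.sum_sub_distrib,
      h.reindex n, sub_self]
  unfold FF at h1
  rw [Finset.sum_sub_distrib, Finset.sum_sub_distrib, Finset.sum_sub_distrib] at h1
  rw [← h.reindex n (fun p => (dot p (σ p) : ℚ) / (nrm p : ℚ))] at h1
  rw [← Finset.mul_sum] at h1
  have h2 : ∑ p ∈ P.erase 0, (crs p (σ p) : ℚ) = 1 := by exact_mod_cast h.sum_crs n
  rw [h2] at h1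
  have h3 : ∑ p ∈ P.erase 0, ((3 : ℚ) - dt p (σ (σ p))) = ∑ p ∈ P.erase 0,
      (3 - (dot (σ p) (σ (σ p)) : ℚ) / nrm (σ p) - (dot p (σ p) : ℚ) / nrm (σ p)) := by
    apply Finset.sum_congr rfl
    intro p hp
    have d1 := n.det p hp
    have d2 := n.det _ (n.mem p hp)
    have hn : (nrm (σ p) : ℚ) ≠ 0 := by exact_mod_cast (nrm_pos_right d1).ne'
    have key : dot (σ p) (σ (σ p)) + dot p (σ p) = dt p (σ (σ p)) * nrm (σ p) := by
      have e1 : dt p (σ (σ p)) * nrm (σ p) =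
        dt p (σ p) * dot (σ p) (σ (σ p)) + dt (σ p) (σ (σ p)) * dot p (σ p) := by
        unfold dt dot nrm; ring
      rw [e1, d1, d2]; ring
    have key' : (dot (σ p) (σ (σ p)) : ℚ) + dot p (σ p) = dt p (σ (σ p)) * nrm (σ p) := by
      exact_mod_cast key
    rw [sub_sub, ← add_div, key', mul_div_assoc, div_self hn, mul_one]
  rw [Finset.sum_sub_distrib, Finset.sum_sub_distrib, Finset.sum_sub_distrib] at h3
  have h4 : ∑ p ∈ P.erase 0, ((3 : ℚ) - dt p (σ (σ p))) = 12 := by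
    rw [Finset.sum_sub_distrib, h3]
    linarith
  exact_mod_cast h4

lemma RP.card12 (h : RP A B P Q) : (P.erase 0).card + (Q.erase 0).card = 12 := by
  obtain ⟨σ, ω, n⟩ := h.exNx
  have h1 := h.sum12 n
  have h2 := h.cardQ n
  have h3 : ∑ p ∈ P.erase 0, (3 - dt p (σ (σ p))) =
      ∑ p ∈ P.erase 0, (2 - dt p (σ (σ p))) + (P.erase 0).card := by
    rw [Finset.card_eq_sum_ones]
    push_cast
    rw [← Finset.sum_add_distrib]
    apply Finset.sum_congr rfl
    intro p _; ring
  omega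

end

section
variable {A B : Set (Fin 2 → ℝ)} {P Q : Finset V} {σ ω : V → V}

def stdT : Set (Fin 2 → ℝ) := {z | 0 < z 0 ∧ 0 ≤ z 1 ∧ z 0 + z 1 ≤ 1}

lemma stdT_meas : MeasurableSet stdT := by
  have h0 : Measurable (fun z : Fin 2 → ℝ => z 0) := measurable_pi_apply 0
  have h1 : Measurable (fun z : Fin 2 → ℝ => z 1) := measurable_pi_apply 1
  exact (measurableSet_lt measurable_const h0).inter
    ((measurableSet_le measurable_const h1).inter (measurableSet_le (h0.add h1) measurable_const))

lemma stdT_vol : volume stdT * 2 = 1 := by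
  have hT : MeasurableSet {z : ℝ × ℝ | 0 < z.1 ∧ 0 ≤ z.2 ∧ z.1 + z.2 ≤ 1} :=
    (measurableSet_lt measurable_const measurable_fst).inter
      ((measurableSet_le measurable_const measurable_snd).inter
        (measurableSet_le (measurable_fst.add measurable_snd) measurable_const))
  have e : stdT = MeasurableEquiv.finTwoArrow ⁻¹'
      {z : ℝ × ℝ | 0 < z.1 ∧ 0 ≤ z.2 ∧ z.1 + z.2 ≤ 1} := by
    ext z; simp [stdT, MeasurableEquiv.finTwoArrow]
  rw [e, (volume_preserving_finTwoArrow ℝ).measure_preimage hT.nullMeasurableSet,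
    Measure.volume_eq_prod, Measure.prod_apply hT]
  have e2 : ∀ x : ℝ, volume (Prod.mk x ⁻¹' {z : ℝ × ℝ | 0 < z.1 ∧ 0 ≤ z.2 ∧ z.1 + z.2 ≤ 1}) =
      (Set.Ioc (0 : ℝ) 1).indicator (fun x => ENNReal.ofReal (1 - x)) x := by
    intro x
    by_cases hx : x ∈ Set.Ioc (0 : ℝ) 1
    · rw [Set.indicator_of_mem hx]
      have : (Prod.mk x ⁻¹' {z : ℝ × ℝ | 0 < z.1 ∧ 0 ≤ z.2 ∧ z.1 + z.2 ≤ 1}) = Set.Icc 0 (1 - x) := by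
        ext y
        simp only [Set.mem_preimage, Set.mem_ofPred_eq, Set.mem_Icc]
        constructor
        · rintro ⟨_, b, c⟩; exact ⟨b, by linarith⟩
        · rintro ⟨b, c⟩; exact ⟨hx.1, b, by linarith⟩
      rw [this, Real.volume_Icc]; simp
    · rw [Set.indicator_of_notMem hx]
      have : (Prod.mk x ⁻¹' {z : ℝ × ℝ | 0 < z.1 ∧ 0 ≤ z.2 ∧ z.1 + z.2 ≤ 1}) = ∅ := by
        ext y
        simp only [Set.mem_preimage, Set.mem_ofPred_eq, Set.mem_empty_iff_false, iff_false]
        rintro ⟨a, b, c⟩; exact hx ⟨a, by linarith⟩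
      rw [this, measure_empty]
  simp_rw [e2]
  rw [lintegral_indicator measurableSet_Ioc, ← ofReal_integral_eq_lintegral_ofReal,
    ← intervalIntegral.integral_of_le zero_le_one]
  · rw [intervalIntegral.integral_sub (by simp) (by simp)]
    simp only [intervalIntegral.integral_const, integral_id]
    rw [show (2 : ENNReal) = ENNReal.ofReal 2 by simp, ← ENNReal.ofReal_mul (by norm_num)]
    norm_num
  · exact (Continuous.integrableOn_Icc (by fun_prop)).mono_set Set.Ioc_subset_Icc_self
  · filter_upwards [ae_restrict_mem measurableSet_Ioc] with x hx
    simp only [Pi.zero_apply]; linarith [hx.2]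

noncomputable def Lm (u v : V) : (Fin 2 → ℝ) →ₗ[ℝ] (Fin 2 → ℝ) :=
  Matrix.toLin' !![(v.2 : ℝ), -(v.1 : ℝ); -(u.2 : ℝ), (u.1 : ℝ)]

lemma Lm_det {u v : V} (h : dt u v = 1) : LinearMap.det (Lm u v) = 1 := by
  unfold Lm
  rw [LinearMap.det_toLin', Matrix.det_fin_two]
  have h' : (u.1 : ℝ) * v.2 - u.2 * v.1 = 1 := by unfold dt at h; exact_mod_cast h
  simp
  linear_combination h'

lemma Lm_zero (u v : V) (x : Fin 2 → ℝ) : Lm u v x 0 = - rdt v x := by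
  simp [Lm, rdt, Matrix.mulVec, dotProduct, Fin.sum_univ_two]; ring

lemma Lm_one (u v : V) (x : Fin 2 → ℝ) : Lm u v x 1 = rdt u x := by
  simp [Lm, rdt, Matrix.mulVec, dotProduct, Fin.sum_univ_two]; ring

lemma tri_vol {u v : V} (h : dt u v = 1) : volume (Lm u v ⁻¹' stdT) * 2 = 1 := by
  rw [Measure.addHaar_preimage_linearMap volume (by rw [Lm_det h]; exact one_ne_zero), Lm_det h]
  simp [stdT_vol]

lemma RP.vol (h : RP A B P Q) : volume A * 2 = (P.erase 0).card := by
  obtain ⟨σ, ω, n⟩ := h.exNx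
  have hmem : ∀ p x, x ∈ Lm p (σ p) ⁻¹' stdT ↔
      0 < - rdt (σ p) x ∧ 0 ≤ rdt p x ∧ - rdt (σ p) x + rdt p x ≤ 1 := by
    intro p x
    simp only [Set.mem_preimage, stdT, Set.mem_ofPred_eq, Lm_zero, Lm_one]
  have hA : A = {0} ∪ ⋃ p ∈ P.erase 0, Lm p (σ p) ⁻¹' stdT := by
    ext x
    simp only [Set.mem_union, Set.mem_singleton_iff, Set.mem_iUnion, hmem, exists_prop]
    constructor
    · intro hx
      by_cases hx0 : x = 0
      · exact Or.inl hx0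
      · right
        obtain ⟨p, hp, h1, h2⟩ := h.cone_exists n hx0
        refine ⟨p, hp, h2, h1, ?_⟩
        have h3 := (h.memA x).1 hx _ (n.omem p hp)
        rw [rbasis (n.det p hp), n.o1 p hp, n.o2 p hp] at h3
        push_cast at h3
        linarith
    · rintro (rfl | ⟨p, hp, h1, h2, h3⟩)
      · rw [h.memA]; intro q _; simp [pr]
      · rw [h.memA]
        intro q hq
        rw [rbasis (n.det p hp)]
        have i1 : (-1 : ℝ) ≤ dot q p := by exact_mod_cast h.ge (Finset.mem_of_mem_erase hp) hq
        have i2 : (-1 : ℝ) ≤ dot q (σ p) := by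
          exact_mod_cast h.ge (Finset.mem_of_mem_erase (n.mem p hp)) hq
        nlinarith
  have hv : volume A = volume (⋃ p ∈ P.erase 0, Lm p (σ p) ⁻¹' stdT) := by
    rw [hA]
    apply le_antisymm
    · refine (measure_union_le _ _).trans ?_
      simp
    · exact measure_mono Set.subset_union_right
  rw [hv, measure_biUnion_finset]
  · rw [Finset.sum_mul, Finset.sum_congr rfl (fun p hp => tri_vol (n.det p hp))]
    simp
  · intro p hp p' hp' hne
    rw [Function.onFun, Set.disjoint_left]
    intro x hx hx'
    rw [hmem] at hx hx'
    exact hne (h.cone_unique n hp hp' hx.2.1 hx.1 hx'.2.1 hx'.1)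
  · intro p _
    exact (LinearMap.continuous_of_finiteDimensional _).measurable stdT_meas

lemma fin_lattice {K : Set (Fin 2 → ℝ)} (hK : Bornology.IsBounded K) :
    {p : V | emb p ∈ K}.Finite := by
  obtain ⟨R, hR⟩ := hK.subset_closedBall 0
  obtain ⟨N, hN⟩ := exists_nat_ge R
  apply Set.Finite.subset ((Set.finite_Icc (-(N : ℤ)) N).prod (Set.finite_Icc (-(N : ℤ)) N))
  intro p hp
  have h1 := hR hp
  rw [mem_closedBall_zero_iff] at h1
  have h2 := (norm_le_pi_norm (emb p) 0).trans (h1.trans hN)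
  have h3 := (norm_le_pi_norm (emb p) 1).trans (h1.trans hN)
  simp only [emb, Real.norm_eq_abs, Matrix.cons_val_zero, Matrix.cons_val_one] at h2 h3
  rw [abs_le] at h2 h3
  simp only [Set.mem_prod, Set.mem_Icc]
  refine ⟨⟨?_, ?_⟩, ?_, ?_⟩
  · exact_mod_cast h2.1
  · exact_mod_cast h2.2
  · exact_mod_cast h3.1
  · exact_mod_cast h3.2

lemma ray_bounded {K : Set (Fin 2 → ℝ)} (hK : Bornology.IsBounded K) {x : Fin 2 → ℝ}
    (h : ∀ t : ℝ, 0 ≤ t → t • x ∈ K) : x = 0 := by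
  obtain ⟨R, hR⟩ := hK.subset_closedBall 0
  by_contra hx
  have hn : 0 < ‖x‖ := norm_pos_iff.2 hx
  have hR0 : 0 ≤ R := by
    have := hR (h 0 le_rfl)
    rw [mem_closedBall_zero_iff] at this
    exact (norm_nonneg _).trans this
  have := hR (h ((R + 1) / ‖x‖) (by positivity))
  rw [mem_closedBall_zero_iff, norm_smul, Real.norm_of_nonneg (by positivity)] at this
  rw [div_mul_cancel₀ _ hn.ne'] at this
  linarith

lemma halfspace_convex (x : Fin 2 → ℝ) : Convex ℝ {y : Fin 2 → ℝ | -1 ≤ x 0 * y 0 + x 1 * y 1} := by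
  intro y hy z hz a b ha hb hab
  simp only [Set.mem_ofPred_eq, Pi.add_apply, Pi.smul_apply, smul_eq_mul] at *
  nlinarith

lemma dual_bounded {D : Set (Fin 2 → ℝ)} (h0 : (0 : Fin 2 → ℝ) ∈ interior D) :
    Bornology.IsBounded (dualPolygon D) := by
  obtain ⟨ε, hε, hb⟩ := Metric.mem_nhds_iff.1 (mem_interior_iff_mem_nhds.1 h0)
  have hin : ∀ i : Fin 2, ∀ c : ℝ, |c| < ε → Pi.single i c ∈ D := by
    intro i c hc
    apply hb
    rw [mem_ball_zero_iff, Pi.norm_single]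
    exact hc
  have hc1 : |ε / 2| < ε := by rw [abs_of_pos (by linarith)]; linarith
  have hc2 : |-(ε / 2)| < ε := by rw [abs_neg]; exact hc1
  refine (Metric.isBounded_closedBall (x := (0 : Fin 2 → ℝ)) (r := 2 / ε)).subset ?_
  intro x hx
  rw [mem_closedBall_zero_iff, pi_norm_le_iff_of_nonneg (by positivity)]
  have a1 := hx _ (hin 0 _ hc1)
  have a2 := hx _ (hin 0 _ hc2)
  have b1 := hx _ (hin 1 _ hc1)
  have b2 := hx _ (hin 1 _ hc2)
  simp [Pi.single_apply] at a1 a2 b1 b2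
  intro i
  rw [Real.norm_eq_abs, abs_le, ← neg_div, div_le_iff₀ hε, le_div_iff₀ hε]
  fin_cases i <;> simp <;> constructor <;> linarith

lemma double_dual {D : Set (Fin 2 → ℝ)} (hc : Convex ℝ D) (hcl : IsClosed D) (h0 : (0 : Fin 2 → ℝ) ∈ D)
    {x : Fin 2 → ℝ} (hx : ∀ w ∈ dualPolygon D, -1 ≤ w 0 * x 0 + w 1 * x 1) : x ∈ D := by
  by_contra hxD
  obtain ⟨f, u, hf1, hf2⟩ := geometric_hahn_banach_point_closed hc hcl hxD
  have hu : u < 0 := by simpa using hf2 0 h0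
  set a := f (Pi.single 0 1)
  set b := f (Pi.single 1 1)
  have hf : ∀ y, f y = a * y 0 + b * y 1 := by
    intro y
    have : y = y 0 • (Pi.single 0 1 : Fin 2 → ℝ) + y 1 • (Pi.single 1 1 : Fin 2 → ℝ) := by
      ext i; fin_cases i <;> simp
    conv_lhs => rw [this]
    rw [map_add, map_smul, map_smul]
    simp only [smul_eq_mul]; ring
  have e : ∀ y : Fin 2 → ℝ, (![a / (-u), b / (-u)] : Fin 2 → ℝ) 0 * y 0 +
      (![a / (-u), b / (-u)] : Fin 2 → ℝ) 1 * y 1 = f y / (-u) := by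
    intro y; rw [hf]; simp; ring
  have hw : (![a / (-u), b / (-u)] : Fin 2 → ℝ) ∈ dualPolygon D := by
    intro y hy
    rw [e, le_div_iff₀ (by linarith)]
    linarith [hf2 y hy]
  have := hx _ hw
  rw [e, le_div_iff₀ (by linarith)] at this
  linarith

lemma latticeEmbed_eq (p : Fin 2 → ℤ) : latticeEmbed p = emb (p 0, p 1) := by
  ext i; fin_cases i <;> simp [latticeEmbed, emb]

lemma exists_RP (D : Set (Fin 2 → ℝ)) (hD : IsReflexive D) : ∃ P Q, RP D (dualPolygon D) P Q := by
  obtain ⟨⟨⟨S, hS⟩, -⟩, h0, hdual⟩ := hD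
  have h0' : (0 : Fin 2 → ℝ) ∈ D := interior_subset h0
  have hcomp : IsCompact D := by
    rw [hS]
    exact Set.Finite.isCompact_convexHull (𝕜 := ℝ) (S.finite_toSet.image _)
  have hconv : Convex ℝ D := by rw [hS]; exact convex_convexHull _ _
  have hDb := hcomp.isBounded
  have hBb := dual_bounded h0
  have fP := fin_lattice hDb
  have fQ := fin_lattice hBb
  have mP : ∀ p, p ∈ fP.toFinset ↔ emb p ∈ D := by intro p; simp
  have mQ : ∀ p, p ∈ fQ.toFinset ↔ emb p ∈ dualPolygon D := by intro p; simp
  have hullA : D ⊆ convexHull ℝ (emb '' (fP.toFinset : Set V)) := by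
    conv_lhs => rw [hS]
    apply convexHull_mono
    rintro _ ⟨p, hp, rfl⟩
    refine ⟨(p 0, p 1), ?_, (latticeEmbed_eq p).symm⟩
    rw [Finset.mem_coe, mP, ← latticeEmbed_eq, hS]
    exact subset_convexHull _ _ ⟨p, hp, rfl⟩
  have hullB : dualPolygon D ⊆ convexHull ℝ (emb '' (fQ.toFinset : Set V)) := by
    conv_lhs => rw [hdual]
    apply convexHull_mono
    rintro _ ⟨hx, p, rfl⟩
    refine ⟨(p 0, p 1), ?_, (latticeEmbed_eq p).symm⟩
    rw [Finset.mem_coe, mQ, ← latticeEmbed_eq]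
    exact hx
  have memB : ∀ x, x ∈ dualPolygon D ↔ ∀ p ∈ fP.toFinset, -1 ≤ pr p x := by
    intro x
    constructor
    · intro hx p hp
      have := hx _ ((mP p).1 hp)
      simp [emb] at this
      unfold pr; linarith
    · intro hx
      have : convexHull ℝ (emb '' (fP.toFinset : Set V)) ⊆ {y | -1 ≤ x 0 * y 0 + x 1 * y 1} := by
        apply convexHull_min _ (halfspace_convex x)
        rintro _ ⟨p, hp, rfl⟩
        have := hx p hp
        simp only [Set.mem_ofPred_eq]
        simp [emb]
        unfold pr at this; linarith
      intro y hy
      exact this (hullA hy)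
  have memA : ∀ x, x ∈ D ↔ ∀ q ∈ fQ.toFinset, -1 ≤ pr q x := by
    intro x
    constructor
    · intro hx q hq
      have := (mQ q).1 hq x hx
      simpa [emb, pr] using this
    · intro hx
      have : convexHull ℝ (emb '' (fQ.toFinset : Set V)) ⊆ {y | -1 ≤ x 0 * y 0 + x 1 * y 1} := by
        apply convexHull_min _ (halfspace_convex x)
        rintro _ ⟨p, hp, rfl⟩
        have := hx p hp
        simp only [Set.mem_ofPred_eq]
        simp [emb]
        unfold pr at this; linarith
      apply double_dual hconv hcomp.isClosed h0'
      intro w hw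
      have := this (hullB hw)
      simp only [Set.mem_ofPred_eq] at this
      linarith
  have prs : ∀ (q : V) (t : ℝ) (x : Fin 2 → ℝ), pr q (t • x) = t * pr q x := by
    intro q t x; simp [pr]; ring
  refine ⟨fP.toFinset, fQ.toFinset, hullA, hullB, memA, memB, ?_, ?_, ?_, ?_⟩
  · intro p
    rw [mP, memA]
    simp only [pr_emb]
    norm_cast
  · intro p
    rw [mQ, memB]
    simp only [pr_emb]
    norm_cast
  · intro x hx
    by_contra hcon
    push Not at hcon
    apply hx
    apply ray_bounded hDb
    intro t ht
    rw [memA]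
    intro q hq
    rw [prs]
    have := mul_nonneg ht (hcon q hq)
    linarith
  · intro x hx
    by_contra hcon
    push Not at hcon
    apply hx
    apply ray_bounded hBb
    intro t ht
    rw [memB]
    intro q hq
    rw [prs]
    have := mul_nonneg ht (hcon q hq)
    linarith

end

end Twelve

/-- For a reflexive lattice polygon `Δ` with dual polygon `∇`, the sum of the normalized
volumes (twice the Euclidean areas) of `Δ` and `∇` equals 12. -/
theorem stmt4 (Δ : Set (Fin 2 → ℝ)) (hΔ : IsReflexive Δ) :
    volume Δ * 2 + volume (dualPolygon Δ) * 2 = 12 := by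
  obtain ⟨P, Q, h⟩ := Twelve.exists_RP Δ hΔ
  rw [h.vol, h.symm.vol]
  exact_mod_cast h.card12
end

section
/- For every A, B, C ∈ ℂ and every natural number d, the coefficient of the monomial x^d y^d in the d-th power of the polynomial x²y + xy² + A + Bx + Cx²y² (an element of the polynomial ring ℂ[x, y]) equals the coefficient of x^d y^d in the d-th power of the polynomial x²y + xy² + A + (B + AC)x + BCx². -/
open MvPolynomial Finsupp

noncomputable def phi6 : MvPolynomial (Fin 2) ℂ →ₐ[ℂ] Polynomial (Polynomial ℂ) :=
  MvPolynomial.aeval ![Polynomial.C Polynomial.X, Polynomial.X]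

lemma phi6_coeff (p : MvPolynomial (Fin 2) ℂ) (m : Fin 2 →₀ ℕ) :
    MvPolynomial.coeff m p = ((phi6 p).coeff (m 1)).coeff (m 0) := by
  induction p using MvPolynomial.induction_on' with
  | monomial u a =>
    have h : phi6 (MvPolynomial.monomial u a)
        = Polynomial.monomial (u 1) (Polynomial.monomial (u 0) a) := by
      rw [phi6, MvPolynomial.aeval_monomial, Finsupp.prod_fintype _ _ (by simp)]
      simp only [Fin.prod_univ_two, Matrix.cons_val_zero, Matrix.cons_val_one]
      rw [← Polynomial.C_mul_X_pow_eq_monomial, ← Polynomial.C_mul_X_pow_eq_monomial]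
      simp [IsScalarTower.algebraMap_apply ℂ (Polynomial ℂ) (Polynomial (Polynomial ℂ)), mul_assoc]
    rw [h, MvPolynomial.coeff_monomial, Polynomial.coeff_monomial]
    by_cases h1 : u 1 = m 1
    · rw [if_pos h1, Polynomial.coeff_monomial]
      by_cases h0 : u 0 = m 0
      · have : u = m := by
          ext i
          fin_cases i
          · exact h0
          · exact h1
        rw [if_pos h0, if_pos this]
      · rw [if_neg h0, if_neg (fun e => h0 (by rw [e]))]
    · rw [if_neg h1, if_neg (fun e => h1 (by rw [e])), Polynomial.coeff_zero]
  | add p q hp hq => simp [hp, hq]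

lemma key6 {R : Type*} [CommRing R] [IsDomain R] (u v a c : R) (hu : u ≠ 0) (d : ℕ) :
    ((Polynomial.C v + Polynomial.C a * Polynomial.X
        + Polynomial.C (u * c) * Polynomial.X ^ 2) ^ d).coeff d
    = ((Polynomial.C (u * v) + Polynomial.C a * Polynomial.X
        + Polynomial.C c * Polynomial.X ^ 2) ^ d).coeff d := by
  have h : ((Polynomial.C (u * v) + Polynomial.C a * Polynomial.X
        + Polynomial.C c * Polynomial.X ^ 2) ^ d).comp (Polynomial.C u * Polynomial.X)
      = Polynomial.C (u ^ d) * (Polynomial.C v + Polynomial.C a * Polynomial.X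
        + Polynomial.C (u * c) * Polynomial.X ^ 2) ^ d := by
    rw [Polynomial.pow_comp, Polynomial.C_pow, ← mul_pow]
    congr 1
    simp
    ring
  have h2 := congrArg (fun p => Polynomial.coeff p d) h
  simp only [Polynomial.comp_C_mul_X_coeff, Polynomial.coeff_C_mul] at h2
  rw [mul_comm] at h2
  exact (mul_left_cancel₀ (pow_ne_zero d hu) h2).symm

/-- Mutation invariance of periods (Example 3.8): for all `A, B, C ∈ ℂ` and `d ∈ ℕ`, the
coefficient of `x^d y^d` in `(x²y + xy² + A + Bx + Cx²y²)^d` equals the coefficient of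
`x^d y^d` in `(x²y + xy² + A + (B + AC)x + BCx²)^d`. -/
theorem stmt6 (A B C' : ℂ) (d : ℕ) :
    MvPolynomial.coeff (Finsupp.single 0 d + Finsupp.single 1 d)
      ((X 0 ^ 2 * X 1 + X 0 * X 1 ^ 2 + C A + C B * X 0
          + C C' * X 0 ^ 2 * X 1 ^ 2 : MvPolynomial (Fin 2) ℂ) ^ d)
    = MvPolynomial.coeff (Finsupp.single 0 d + Finsupp.single 1 d)
      ((X 0 ^ 2 * X 1 + X 0 * X 1 ^ 2 + C A + C (B + A * C') * X 0
          + C (B * C') * X 0 ^ 2 : MvPolynomial (Fin 2) ℂ) ^ d) := by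
  have hu : (1 + Polynomial.C C' * Polynomial.X : Polynomial ℂ) ≠ 0 := by
    intro h
    have := congrArg (fun p => Polynomial.coeff p 0) h
    simp at this
  have hC : ∀ z : ℂ, phi6 (C z) = Polynomial.C (Polynomial.C z) := by
    intro z
    simp [phi6, IsScalarTower.algebraMap_apply ℂ (Polynomial ℂ) (Polynomial (Polynomial ℂ))]
  have hx : phi6 (X 0) = Polynomial.C Polynomial.X := by simp [phi6]
  have hy : phi6 (X 1) = Polynomial.X := by simp [phi6]
  have key := key6 (1 + Polynomial.C C' * Polynomial.X : Polynomial ℂ)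
    (Polynomial.C A + Polynomial.C B * Polynomial.X) (Polynomial.X ^ 2) Polynomial.X hu d
  have f1 : phi6 (X 0 ^ 2 * X 1 + X 0 * X 1 ^ 2 + C A + C B * X 0 + C C' * X 0 ^ 2 * X 1 ^ 2)
      = Polynomial.C (Polynomial.C A + Polynomial.C B * Polynomial.X)
        + Polynomial.C (Polynomial.X ^ 2) * Polynomial.X
        + Polynomial.C ((1 + Polynomial.C C' * Polynomial.X) * Polynomial.X)
          * Polynomial.X ^ 2 := by
    simp only [map_pow, map_add, map_mul, hC, hx, hy, map_one]
    ring
  have f2 : phi6 (X 0 ^ 2 * X 1 + X 0 * X 1 ^ 2 + C A + C (B + A * C') * X 0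
        + C (B * C') * X 0 ^ 2)
      = Polynomial.C ((1 + Polynomial.C C' * Polynomial.X)
          * (Polynomial.C A + Polynomial.C B * Polynomial.X))
        + Polynomial.C (Polynomial.X ^ 2) * Polynomial.X
        + Polynomial.C Polynomial.X * Polynomial.X ^ 2 := by
    simp only [map_pow, map_add, map_mul, hC, hx, hy, map_one]
    ring
  have e1 : (Finsupp.single 0 d + Finsupp.single 1 d : Fin 2 →₀ ℕ) 1 = d := by simp
  rw [phi6_coeff, phi6_coeff, e1, map_pow, map_pow, f1, f2, key]
end

section
/- For every A, B, C ∈ ℂ and every natural number d, the coefficient of the monomial x^d y^d in the d-th power of the polynomial x²y + xy² + A + Bx + Cx²y² (an element of ℂ[x, y]) equals the sum, over all triples (k, l, m) of natural numbers with 2k + 3l + 2m = d, of d!/(k!·l!·m!·(k+l)!·(l+m)!) · A^{l+m} · B^k · C^m. -/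
open MvPolynomial

lemma stmt7_mon (a b : ℕ) (c : ℂ) :
    (monomial (Finsupp.single 0 a + Finsupp.single 1 b) c : MvPolynomial (Fin 2) ℂ)
      = C c * X 0 ^ a * X 1 ^ b := by
  rw [mul_assoc, X_pow_eq_monomial, X_pow_eq_monomial, monomial_mul, C_mul_monomial]
  simp

/-- The period computation of Example 3.8 for the del Pezzo surface `S₇`: for all
`A, B, C ∈ ℂ` and `d ∈ ℕ`, the coefficient of `x^d y^d` in
`(x²y + xy² + A + Bx + Cx²y²)^d` equals
`∑_{2k+3l+2m=d} d!/(k! l! m! (k+l)! (l+m)!) · A^{l+m} B^k C^m`. -/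
theorem stmt7 (A B C' : ℂ) (d : ℕ) :
    MvPolynomial.coeff (Finsupp.single 0 d + Finsupp.single 1 d)
      ((X 0 ^ 2 * X 1 + X 0 * X 1 ^ 2 + C A + C B * X 0
          + C C' * X 0 ^ 2 * X 1 ^ 2 : MvPolynomial (Fin 2) ℂ) ^ d)
    = ∑ k ∈ Finset.range (d + 1), ∑ l ∈ Finset.range (d + 1), ∑ m ∈ Finset.range (d + 1),
        if 2 * k + 3 * l + 2 * m = d then
          (d.factorial : ℂ) /
              ((k.factorial : ℂ) * l.factorial * m.factorial
                * (k + l).factorial * (l + m).factorial)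
            * A ^ (l + m) * B ^ k * C' ^ m
        else 0 := by
  have h1 := Finset.sum_pow_eq_sum_piAntidiag (Finset.univ : Finset (Fin 5))
    (fun i => monomial (Finsupp.single 0 (![2,1,0,1,2] i) + Finsupp.single 1 (![1,2,0,0,2] i))
      (![1,1,A,B,C'] i) : Fin 5 → MvPolynomial (Fin 2) ℂ) d
  have h2 : (X 0 ^ 2 * X 1 + X 0 * X 1 ^ 2 + C A + C B * X 0
          + C C' * X 0 ^ 2 * X 1 ^ 2 : MvPolynomial (Fin 2) ℂ) =
      ∑ i : Fin 5, monomial (Finsupp.single 0 (![2,1,0,1,2] i)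
        + Finsupp.single 1 (![1,2,0,0,2] i)) (![1,1,A,B,C'] i) := by
    simp only [Fin.sum_univ_five, stmt7_mon]
    simp
  rw [h2, h1, coeff_sum]
  have h3 : ∀ n : Fin 5 → ℕ, coeff (Finsupp.single 0 d + Finsupp.single 1 d)
      ((Nat.multinomial Finset.univ n : MvPolynomial (Fin 2) ℂ) *
        ∏ i : Fin 5, (monomial (Finsupp.single 0 (![2,1,0,1,2] i)
        + Finsupp.single 1 (![1,2,0,0,2] i)) (![1,1,A,B,C'] i) : MvPolynomial (Fin 2) ℂ) ^ n i)
      = if 2 * n 0 + n 1 + n 3 + 2 * n 4 = d ∧ n 0 + 2 * n 1 + 2 * n 4 = d then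
          (Nat.multinomial Finset.univ n : ℂ) * (A ^ n 2 * B ^ n 3 * C' ^ n 4) else 0 := by
    intro n
    have : (∏ i : Fin 5, (monomial (Finsupp.single 0 (![2,1,0,1,2] i)
        + Finsupp.single 1 (![1,2,0,0,2] i)) (![1,1,A,B,C'] i) : MvPolynomial (Fin 2) ℂ) ^ n i)
        = monomial (Finsupp.single 0 (2 * n 0 + n 1 + n 3 + 2 * n 4)
          + Finsupp.single 1 (n 0 + 2 * n 1 + 2 * n 4)) (A ^ n 2 * B ^ n 3 * C' ^ n 4) := by
      simp only [Fin.prod_univ_five, stmt7_mon]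
      simp
      ring
    rw [this, ← map_natCast (C : ℂ →+* MvPolynomial (Fin 2) ℂ), coeff_C_mul, coeff_monomial,
      mul_ite, mul_zero]
    congr 1
    rw [eq_iff_iff, DFunLike.ext_iff]
    simp [Fin.forall_fin_two]
  simp only [h3]
  rw [← Finset.sum_filter]
  simp only [← Finset.sum_product']
  rw [← Finset.sum_filter]
  refine Finset.sum_nbij' (fun n => (n 3, n 0, n 4))
    (fun p => ![p.2.1, p.1 + p.2.1, p.2.1 + p.2.2, p.1, p.2.2]) ?_ ?_ ?_ ?_ ?_
  · intro n hn
    simp [Fin.sum_univ_five] at hn ⊢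
    omega
  · rintro ⟨k, l, m⟩ hn
    simp [Fin.sum_univ_five] at hn ⊢
    omega
  · intro n hn
    simp [Fin.sum_univ_five] at hn
    ext i
    fin_cases i <;> simp <;> omega
  · rintro ⟨k, l, m⟩ hn
    simp
  · intro n hn
    simp [Fin.sum_univ_five] at hn
    have e1 : n 1 = n 3 + n 0 := by omega
    have e2 : n 2 = n 0 + n 4 := by omega
    have hs := Nat.multinomial_spec (Finset.univ : Finset (Fin 5)) n
    rw [Fin.sum_univ_five, hn.1, Fin.prod_univ_five, e1, e2] at hs
    have hs' := congrArg (Nat.cast : ℕ → ℂ) hs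
    push_cast at hs'
    simp only [e2]
    rw [← hs']
    have f := fun j : ℕ => (Nat.cast_ne_zero (R := ℂ)).2 (Nat.factorial_ne_zero j)
    have f0 := f (n 0)
    have f1 := f (n 3)
    have f2 := f (n 4)
    have f3 := f (n 3 + n 0)
    have f4 := f (n 0 + n 4)
    field_simp
end

section
/- In the fraction field ℚ(a₁, b₁, b₂, λ) of the polynomial ring in four variables a₁, b₁, b₂, λ over ℚ, set x = 1/b₁ − 1/(b₁²b₂) − 1, y = 1/(b₁²b₂) and z = 1/a₁ − 1. Then ((x+y+1)⁶(z+1)/(x·y²) + 1/z − λ) · a₁(1−a₁)(b₁b₂ − b₁²b₂ − 1) = (1−a₁)b₂³ − ((1−a₁)λ − a₁)·a₁·(b₁b₂ − b₁²b₂ − 1). -/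
open MvPolynomial

theorem stmt11_aux {K : Type*} [Field K] (a b c l : K) (ha : a ≠ 0) (ha' : 1 - a ≠ 0)
    (hb : b ≠ 0) (hc : c ≠ 0) (hD : b * c - b ^ 2 * c - 1 ≠ 0) :
    ((1 / b - 1 / (b ^ 2 * c) - 1 + 1 / (b ^ 2 * c) + 1) ^ 6 * (1 / a - 1 + 1) /
        ((1 / b - 1 / (b ^ 2 * c) - 1) * (1 / (b ^ 2 * c)) ^ 2) + 1 / (1 / a - 1) - l)
        * (a * (1 - a) * (b * c - b ^ 2 * c - 1))
      = (1 - a) * c ^ 3 - ((1 - a) * l - a) * a * (b * c - b ^ 2 * c - 1) := by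
  have h1 : 1 / b - 1 / (b ^ 2 * c) - 1 + 1 / (b ^ 2 * c) + 1 = 1 / b := by ring
  have h2 : 1 / b - 1 / (b ^ 2 * c) - 1 = (b * c - b ^ 2 * c - 1) / (b ^ 2 * c) := by
    field_simp
    try ring
  have h3 : 1 / a - 1 = (1 - a) / a := by field_simp
  have h4 : 1 / a - 1 + 1 = 1 / a := by ring
  rw [h1, h4, h2, h3]
  generalize b * c - b ^ 2 * c - 1 = D at *
  field_simp
  try ring

theorem stmt11_ne (p : MvPolynomial (Fin 4) ℚ) (v : Fin 4 → ℚ) (h : eval v p ≠ 0) :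
    algebraMap (MvPolynomial (Fin 4) ℚ) (FractionRing (MvPolynomial (Fin 4) ℚ)) p ≠ 0 := by
  intro h0
  have : p = 0 := (IsFractionRing.injective (MvPolynomial (Fin 4) ℚ)
    (FractionRing (MvPolynomial (Fin 4) ℚ))) (by rw [h0, map_zero])
  exact h (by rw [this, map_zero])

/-- The change-of-variables identity for the Fano threefold `X₂₋₁` (Proposition 4.5):
in `ℚ(a₁, b₁, b₂, λ)`, with `x = 1/b₁ − 1/(b₁²b₂) − 1`, `y = 1/(b₁²b₂)`, `z = 1/a₁ − 1`,
one has `((x+y+1)⁶(z+1)/(xy²) + 1/z − λ) · a₁(1−a₁)(b₁b₂ − b₁²b₂ − 1)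
= (1−a₁)b₂³ − ((1−a₁)λ − a₁) a₁ (b₁b₂ − b₁²b₂ − 1)`. -/
theorem stmt11 :
    letI R := MvPolynomial (Fin 4) ℚ
    letI K := FractionRing R
    let a₁ : K := algebraMap R K (X 0)
    let b₁ : K := algebraMap R K (X 1)
    let b₂ : K := algebraMap R K (X 2)
    let lam : K := algebraMap R K (X 3)
    let x : K := 1 / b₁ - 1 / (b₁ ^ 2 * b₂) - 1
    let y : K := 1 / (b₁ ^ 2 * b₂)
    let z : K := 1 / a₁ - 1
    ((x + y + 1) ^ 6 * (z + 1) / (x * y ^ 2) + 1 / z - lam)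
        * (a₁ * (1 - a₁) * (b₁ * b₂ - b₁ ^ 2 * b₂ - 1))
      = (1 - a₁) * b₂ ^ 3
        - ((1 - a₁) * lam - a₁) * a₁ * (b₁ * b₂ - b₁ ^ 2 * b₂ - 1) := by
  intro a₁ b₁ b₂ lam x y z
  refine stmt11_aux a₁ b₁ b₂ lam ?_ ?_ ?_ ?_ ?_
  · exact stmt11_ne (X 0) (fun _ => 1) (by simp)
  · have := stmt11_ne (1 - X 0) (fun _ => 2) (by norm_num)
    rwa [map_sub, map_one] at this
  · exact stmt11_ne (X 1) (fun _ => 1) (by simp)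
  · exact stmt11_ne (X 2) (fun _ => 1) (by simp)
  · have := stmt11_ne (X 1 * X 2 - X 1 ^ 2 * X 2 - 1) (fun _ => 0) (by norm_num)
    rwa [map_sub, map_sub, map_mul, map_mul, map_pow, map_one] at this
end

section
/- In the fraction field ℚ(a, b, c, λ) of the polynomial ring in four variables a, b, c, λ over ℚ, set x = ab, y = bc and z = c − ab − bc − 1. Then ((x+y+z+1)²/x + (x+y+z+1)⁴/(y·z) − λ) · ab(c − ab − bc − 1) = ac³ − (c − ab − bc − 1)(λab − c²). -/
open MvPolynomial

theorem aux12 {K : Type*} [Field K] (a b c l z : K) (ha : a ≠ 0) (hb : b ≠ 0) (hc : c ≠ 0)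
    (hz : z ≠ 0) (h : z = c - a * b - b * c - 1) :
    ((a * b + b * c + z + 1) ^ 2 / (a * b) + (a * b + b * c + z + 1) ^ 4 / (b * c * z) - l)
        * (a * b * z) = a * c ^ 3 - z * (l * a * b - c ^ 2) := by
  have e : a * b + b * c + z + 1 = c := by rw [h]; ring
  rw [e]
  field_simp
  ring

/-- The change-of-variables identity for the Fano threefold `X₂₋₂` (Proposition 4.5):
in `ℚ(a, b, c, λ)`, with `x = ab`, `y = bc`, `z = c − ab − bc − 1`, one has
`((x+y+z+1)²/x + (x+y+z+1)⁴/(yz) − λ) · ab(c − ab − bc − 1)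
= ac³ − (c − ab − bc − 1)(λab − c²)`. -/
theorem stmt12 :
    letI R := MvPolynomial (Fin 4) ℚ
    letI K := FractionRing R
    let a : K := algebraMap R K (X 0)
    let b : K := algebraMap R K (X 1)
    let c : K := algebraMap R K (X 2)
    let lam : K := algebraMap R K (X 3)
    let x : K := a * b
    let y : K := b * c
    let z : K := c - a * b - b * c - 1
    ((x + y + z + 1) ^ 2 / x + (x + y + z + 1) ^ 4 / (y * z) - lam)
        * (a * b * (c - a * b - b * c - 1))
      = a * c ^ 3 - (c - a * b - b * c - 1) * (lam * a * b - c ^ 2) := by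
  intro a b c lam x y z
  have inj := IsFractionRing.injective (MvPolynomial (Fin 4) ℚ)
    (FractionRing (MvPolynomial (Fin 4) ℚ))
  have hX : ∀ i : Fin 4, algebraMap (MvPolynomial (Fin 4) ℚ)
      (FractionRing (MvPolynomial (Fin 4) ℚ)) (X i) ≠ 0 := fun i h =>
    X_ne_zero (R := ℚ) i (inj (h.trans (map_zero _).symm))
  have hz : z ≠ 0 := by
    intro h
    have h2 : algebraMap (MvPolynomial (Fin 4) ℚ) (FractionRing (MvPolynomial (Fin 4) ℚ))
        (X 2 - X 0 * X 1 - X 1 * X 2 - 1) = algebraMap _ _ 0 := by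
      simp only [map_sub, map_mul, map_one, map_zero]
      exact h
    have h3 := congrArg (eval (fun _ => (0 : ℚ))) (inj h2)
    simp at h3
  exact aux12 a b c lam z (hX 0) (hX 1) (hX 2) hz rfl
end

section
/- In the fraction field ℚ(a₁, b₁, b₂, λ) of the polynomial ring in four variables a₁, b₁, b₂, λ over ℚ, set x = 1/b₁ − 1/(b₁²b₂) − 1, y = 1/(b₁²b₂) and z = a₁. Then ((x+y+1)⁶/(x·y²) + z + 1/z − λ) · a₁(b₁b₂ − b₁²b₂ − 1) = a₁b₂³ − (λa₁ − a₁² − 1)(b₁b₂ − b₁²b₂ − 1). -/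
open MvPolynomial

theorem aux_identity {K : Type*} [Field K] (a b c l : K) (ha : a ≠ 0) (hb : b ≠ 0) (hc : c ≠ 0)
    (hD : b * c - b ^ 2 * c - 1 ≠ 0) :
    (((1 / b - 1 / (b ^ 2 * c) - 1) + 1 / (b ^ 2 * c) + 1) ^ 6 /
        ((1 / b - 1 / (b ^ 2 * c) - 1) * (1 / (b ^ 2 * c)) ^ 2) + a + 1 / a - l)
        * (a * (b * c - b ^ 2 * c - 1))
      = a * c ^ 3 - (l * a - a ^ 2 - 1) * (b * c - b ^ 2 * c - 1) := by
  have h1 : (1 / b - 1 / (b ^ 2 * c) - 1) + 1 / (b ^ 2 * c) + 1 = 1 / b := by ring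
  have h2 : 1 / b - 1 / (b ^ 2 * c) - 1 = (b * c - b ^ 2 * c - 1) / (b ^ 2 * c) := by
    field_simp
    ring
  rw [h1, h2]
  generalize b * c - b ^ 2 * c - 1 = D at hD
  have h3 : (1 / b) ^ 6 / (D / (b ^ 2 * c) * (1 / (b ^ 2 * c)) ^ 2) = c ^ 3 / D := by
    field_simp
  rw [h3]
  field_simp
  ring

/-- The change-of-variables identity for the Fano threefold `X₁₀₋₁ = ℙ¹ × S₁`
(Proposition 4.5): in `ℚ(a₁, b₁, b₂, λ)`, with `x = 1/b₁ − 1/(b₁²b₂) − 1`,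
`y = 1/(b₁²b₂)`, `z = a₁`, one has
`((x+y+1)⁶/(xy²) + z + 1/z − λ) · a₁(b₁b₂ − b₁²b₂ − 1)
= a₁b₂³ − (λa₁ − a₁² − 1)(b₁b₂ − b₁²b₂ − 1)`. -/
theorem stmt15 :
    letI R := MvPolynomial (Fin 4) ℚ
    letI K := FractionRing R
    let a₁ : K := algebraMap R K (X 0)
    let b₁ : K := algebraMap R K (X 1)
    let b₂ : K := algebraMap R K (X 2)
    let lam : K := algebraMap R K (X 3)
    let x : K := 1 / b₁ - 1 / (b₁ ^ 2 * b₂) - 1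
    let y : K := 1 / (b₁ ^ 2 * b₂)
    let z : K := a₁
    ((x + y + 1) ^ 6 / (x * y ^ 2) + z + 1 / z - lam)
        * (a₁ * (b₁ * b₂ - b₁ ^ 2 * b₂ - 1))
      = a₁ * b₂ ^ 3 - (lam * a₁ - a₁ ^ 2 - 1) * (b₁ * b₂ - b₁ ^ 2 * b₂ - 1) := by
  intro a₁ b₁ b₂ lam x y z
  have inj := IsFractionRing.injective (MvPolynomial (Fin 4) ℚ)
    (FractionRing (MvPolynomial (Fin 4) ℚ))
  have hX : ∀ i : Fin 4, algebraMap (MvPolynomial (Fin 4) ℚ)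
      (FractionRing (MvPolynomial (Fin 4) ℚ)) (X i) ≠ 0 := fun i h =>
    X_ne_zero i (inj (h.trans (map_zero _).symm))
  refine aux_identity a₁ b₁ b₂ lam (hX 0) (hX 1) (hX 2) ?_
  intro h
  have h' : (X 1 * X 2 - X 1 ^ 2 * X 2 - 1 : MvPolynomial (Fin 4) ℚ) = 0 := by
    apply inj
    rw [map_zero, ← h]
    simp only [map_sub, map_mul, map_pow, map_one, b₁, b₂]
  have h'' := congrArg (eval (fun _ => (0 : ℚ))) h'
  simp at h''
end
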